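/- arXiv:2001.04579 — 2 statements merged into one kernel-verified Lean document; each statement's English description precedes it below -/
import Mathlib

section
/- Every finitely generated group G embeds quasi-isometrically as a subgroup of a two-generated simple group: there exist a simple group H generated by two elements, a finite generating set of H, a finite generating set of G, and an injective group homomorphism G → H that is a quasi-isometric embedding with respect to the associated word metrics. -/
namespace TBT

/-- The word metric on a group `H` associated to a generating set `A`:  `wordDist A g h` is the
least length of a word in the elements of `A` and their inverses whose product is `g⁻¹ * h`. -/
noncomputable def wordDist {H : Type*} [Group H] (A : Set H) (g h : H) : ℕ :=
  sInf {n | ∃ w : List H, (∀ x ∈ w, x ∈ A ∨ x⁻¹ ∈ A) ∧ w.length = n ∧ w.prod = g⁻¹ * h}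

universe u

section UnitsOfRings

variable {A : Type*} [Ring A]

theorem val_inv_of_sq_zero {u : Aˣ} {X : A} (hu : (u : A) = 1 + X) (hX : X * X = 0) :
    ((u⁻¹ : Aˣ) : A) = 1 - X := by
  rw [Units.inv_eq_of_mul_eq_one_right]
  rw [hu]; noncomm_ring; simp [hX]

theorem val_commutator_of_sq_zero {u v : Aˣ} {X Y : A} (hu : (u : A) = 1 + X)
    (hv : (v : A) = 1 + Y) (hX : X * X = 0) (hY : Y * Y = 0) (hYX : Y * X = 0) :
    ((u * v * u⁻¹ * v⁻¹ : Aˣ) : A) = 1 + X * Y := by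
  push_cast
  rw [val_inv_of_sq_zero hu hX, val_inv_of_sq_zero hv hY, hu, hv]
  simp only [mul_add, add_mul, mul_sub, sub_mul, mul_one, one_mul, mul_assoc, hX, hY, hYX,
    mul_zero, zero_mul]
  abel

/-- A conjugate of `1 + X` commutes with `1 + Y` when the conjugating unit moves `X` off `Y`. -/
theorem commute_conj_inv {h u v : Aˣ} {X Y : A} (hu : (u : A) = 1 + X) (hv : (v : A) = 1 + Y)
    (hX : X * X = 0) (hYX : Y * h * X = 0) (hXY : X * ((h⁻¹ : Aˣ) : A) * Y = 0) :
    Commute (h * u⁻¹ * h⁻¹) v := by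
  have e : ((h * u⁻¹ * h⁻¹ : Aˣ) : A) = 1 - h * X * ((h⁻¹ : Aˣ) : A) := by
    push_cast
    rw [val_inv_of_sq_zero hu hX, mul_sub, sub_mul, mul_one, Units.mul_inv]
  ext
  rw [Units.val_mul _ v, Units.val_mul v, e, hv]
  have h1 : h * X * ((h⁻¹ : Aˣ) : A) * Y = 0 := by
    rw [mul_assoc (h : A), mul_assoc, hXY, mul_zero]
  have h2 : Y * (h * X * ((h⁻¹ : Aˣ) : A)) = 0 := by
    rw [← mul_assoc, ← mul_assoc, hYX, zero_mul]
  simp only [mul_add, add_mul, mul_sub, sub_mul, mul_one, one_mul, h1, h2]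
  abel

theorem commutator_conj_inv_mul {B : Type*} [Group B] {h u v : B}
    (hv : Commute (h * u⁻¹ * h⁻¹) v) (hw : Commute (h * u⁻¹ * h⁻¹) (u * v * u⁻¹ * v⁻¹)) :
    (h * u⁻¹ * h⁻¹ * u) * v * (h * u⁻¹ * h⁻¹ * u)⁻¹ * v⁻¹ = u * v * u⁻¹ * v⁻¹ := by
  generalize h * u⁻¹ * h⁻¹ = z at *
  have h2 : Commute z (u * v * u⁻¹) := by simpa using hw.mul_right hv
  calc (z * u) * v * (z * u)⁻¹ * v⁻¹ = z * (u * v * u⁻¹) * z⁻¹ * v⁻¹ := by group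
    _ = _ := by rw [h2.eq]; group

end UnitsOfRings

section Elementary

open Matrix

variable {ι E : Type*} [Fintype ι] [DecidableEq ι] [Ring E]

/-- The matrix `1 + X` is the value of a unit in the subgroup `K`. -/
def HasUnip (K : Subgroup (Matrix ι ι E)ˣ) (X : Matrix ι ι E) : Prop :=
  ∃ u ∈ K, (u : Matrix ι ι E) = 1 + X

/-- `K` contains all elementary matrices with off-diagonal entry `r`. -/
def HasElem (K : Subgroup (Matrix ι ι E)ˣ) (r : E) : Prop :=
  ∀ i j, i ≠ j → HasUnip K (single i j r)

/-- `M` is a subgroup of `K` that is normalized by `K`. -/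
structure NormalIn {U : Type*} [Group U] (M K : Subgroup U) : Prop where
  le : M ≤ K
  conj : ∀ k ∈ K, ∀ m ∈ M, k * m * k⁻¹ ∈ M

theorem NormalIn.refl {U : Type*} [Group U] (K : Subgroup U) : NormalIn K K :=
  ⟨le_rfl, fun _ hk _ hm => K.mul_mem (K.mul_mem hk hm) (K.inv_mem hk)⟩

theorem NormalIn.commutator_left {U : Type*} [Group U] {M K : Subgroup U} (h : NormalIn M K)
    {u v : U} (hu : u ∈ M) (hv : v ∈ K) : u * v * u⁻¹ * v⁻¹ ∈ M := by
  have := M.mul_mem hu (h.conj v hv _ (M.inv_mem hu))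
  simpa only [mul_assoc] using this

theorem NormalIn.commutator_right {U : Type*} [Group U] {M K : Subgroup U} (h : NormalIn M K)
    {u v : U} (hu : u ∈ K) (hv : v ∈ M) : u * v * u⁻¹ * v⁻¹ ∈ M :=
  M.mul_mem (h.conj u hu v hv) (M.inv_mem hv)

variable {M K : Subgroup (Matrix ι ι E)ˣ}

theorem single_mul_eq_zero {i j k l : ι} (h : j ≠ k) (r s : E) :
    single i j r * single k l s = 0 :=
  single_mul_single_of_ne (c := r) (h := h) (d := s) ..

theorem single_sq_zero {i j : ι} (h : i ≠ j) (r s : E) : single i j r * single i j s = 0 :=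
  single_mul_eq_zero h.symm r s

theorem HasUnip.mul_left (h : NormalIn M K) {i j k : ι} {r s : E} (hij : i ≠ j) (hjk : j ≠ k)
    (hik : i ≠ k) (hr : HasUnip M (single i j r)) (hs : HasUnip K (single j k s)) :
    HasUnip M (single i k (r * s)) := by
  obtain ⟨u, hu, hu'⟩ := hr
  obtain ⟨v, hv, hv'⟩ := hs
  refine ⟨_, h.commutator_left hu hv, ?_⟩
  rw [val_commutator_of_sq_zero hu' hv' (single_sq_zero hij _ _) (single_sq_zero hjk _ _)
    (single_mul_eq_zero hik.symm _ _), single_mul_single_same]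

theorem HasUnip.mul_right (h : NormalIn M K) {i j k : ι} {r s : E} (hij : i ≠ j) (hjk : j ≠ k)
    (hik : i ≠ k) (hr : HasUnip K (single i j r)) (hs : HasUnip M (single j k s)) :
    HasUnip M (single i k (r * s)) := by
  obtain ⟨u, hu, hu'⟩ := hr
  obtain ⟨v, hv, hv'⟩ := hs
  refine ⟨_, h.commutator_right hu hv, ?_⟩
  rw [val_commutator_of_sq_zero hu' hv' (single_sq_zero hij _ _) (single_sq_zero hjk _ _)
    (single_mul_eq_zero hik.symm _ _), single_mul_single_same]

theorem HasElem.mul (h3 : ∀ i j : ι, ∃ k, k ≠ i ∧ k ≠ j) {r s : E} (hr : HasElem K r)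
    (hs : HasElem K s) : HasElem K (r * s) := by
  intro i j hij
  obtain ⟨k, hki, hkj⟩ := h3 i j
  exact (hr i k hki.symm).mul_left (NormalIn.refl K) hki.symm hkj hij (hs k j hkj)

theorem HasElem.pow (h3 : ∀ i j : ι, ∃ k, k ≠ i ∧ k ≠ j) {r : E} (h1 : HasElem K (1 : E))
    (hr : HasElem K r) (n : ℕ) : HasElem K (r ^ n) := by
  induction n with
  | zero => simpa using h1
  | succ n ih => rw [pow_succ]; exact ih.mul h3 hr

/-- A single elementary matrix spreads to all positions. -/
theorem HasUnip.hasElem (h3 : ∀ i j : ι, ∃ k, k ≠ i ∧ k ≠ j) (h : NormalIn M K)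
    (h1 : HasElem K (1 : E)) {i₀ j₀ : ι} (h₀ : i₀ ≠ j₀) {r : E}
    (hr : HasUnip M (single i₀ j₀ r)) : HasElem M r := by
  have row : ∀ j, i₀ ≠ j → HasUnip M (single i₀ j r) := by
    intro j hj
    by_cases hjj : j₀ = j
    · rwa [← hjj]
    · simpa using hr.mul_left h h₀ hjj hj (h1 j₀ j hjj)
  have most : ∀ i j, i ≠ j → i₀ ≠ j → HasUnip M (single i j r) := by
    intro i j hij hj
    by_cases hi : i = i₀
    · rw [hi]; exact row j hj
    · simpa using HasUnip.mul_right h hi hj hij (h1 i i₀ hi) (row j hj)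
  intro i j hij
  by_cases hj : i₀ = j
  · obtain ⟨k, hki, hkj⟩ := h3 i j
    simpa using (most i k hki.symm (hj ▸ hkj.symm)).mul_left h hki.symm hkj hij (h1 k j hkj)
  · exact most i j hij hj

theorem HasElem.of_one (h3 : ∀ i j : ι, ∃ k, k ≠ i ∧ k ≠ j) (h : NormalIn M K)
    (h1 : HasElem M (1 : E)) {r : E} (hr : HasElem K r) : HasElem M r := by
  intro i j hij
  obtain ⟨k, hki, hkj⟩ := h3 i j
  simpa using (h1 i k hki.symm).mul_left h hki.symm hkj hij (hr k j hkj)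

/-- A normal subgroup with an element that displaces the summand cut out by `y` and `x` contains
all elementary matrices with entry `1`. -/
theorem NormalIn.hasElem_one_of_displacement (h3 : ∀ i j : ι, ∃ k, k ≠ i ∧ k ≠ j) [Nonempty ι]
    (h : NormalIn M K) (h1 : HasElem K (1 : E)) {x y : E} (hx : HasElem K x) (hy : HasElem K y)
    (hxy : x * y = 1) {g : (Matrix ι ι E)ˣ} (hg : g ∈ M)
    (hd : ∀ i j, x * (g : Matrix ι ι E) i j * y = 0)
    (hd' : ∀ i j, x * ((g⁻¹ : (Matrix ι ι E)ˣ) : Matrix ι ι E) i j * y = 0) :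
    HasElem M (1 : E) := by
  obtain ⟨i⟩ := ‹Nonempty ι›
  obtain ⟨j, hji, -⟩ := h3 i i
  obtain ⟨k, hki, hkj⟩ := h3 i j
  have hyx := hy.mul h3 hx
  obtain ⟨u, hu, hu'⟩ := hyx i j hji.symm
  obtain ⟨v, hv, hv'⟩ := hyx j k hkj.symm
  have hw := val_commutator_of_sq_zero hu' hv' (single_sq_zero hji.symm _ _)
    (single_sq_zero hkj.symm _ _) (single_mul_eq_zero hki _ _)
  have disp : ∀ (B : Matrix ι ι E), (∀ i j, x * B i j * y = 0) → ∀ p q s t,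
      single p q (y * x) * B * single s t (y * x) = 0 := by
    intro B hB p q s t
    rw [single_mul_mul_single]
    have : y * x * B q s * (y * x) = y * (x * B q s * y) * x := by simp only [mul_assoc]
    rw [this, hB, mul_zero, zero_mul, single_zero]
  have hX := single_sq_zero hji.symm (y * x) (y * x)
  have hidem : y * x * (y * x) = y * x := by
    rw [mul_assoc, ← mul_assoc x, hxy, one_mul]
  rw [single_mul_single_same, hidem] at hw
  have c1 := commute_conj_inv (h := g) hu' hv' hX (disp _ hd _ _ _ _) (disp _ hd' _ _ _ _)
  have c2 := commute_conj_inv (h := g) hu' hw hX (disp _ hd _ _ _ _) (disp _ hd' _ _ _ _)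
  have hmem : g * u⁻¹ * g⁻¹ * u ∈ M := by
    simpa using h.commutator_left hg (K.inv_mem hu)
  have key : HasUnip M (single i k (y * x)) := by
    refine ⟨_, h.commutator_left hmem hv, ?_⟩
    rw [commutator_conj_inv_mul c1 c2, hw]
  have all := key.hasElem h3 h h1 hki.symm
  have : HasElem M (x * (y * x)) := by
    intro i j hij
    obtain ⟨k, hki, hkj⟩ := h3 i j
    exact HasUnip.mul_right h hki.symm hkj hij (hx i k hki.symm) (all k j hkj)
  rw [← mul_assoc, hxy, one_mul] at this
  intro i j hij
  obtain ⟨k, hki, hkj⟩ := h3 i j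
  simpa [hxy] using (this i k hki.symm).mul_left h hki.symm hkj hij (hy k j hkj)

end Elementary

section Monomial

open Matrix

variable {ι E : Type*} [Fintype ι] [DecidableEq ι] [Ring E] {K : Subgroup (Matrix ι ι E)ˣ}

/-- Diagonal matrices with invertible entries. -/
def diagUnits : (ι → Eˣ) →* (Matrix ι ι E)ˣ :=
  (Units.map (Matrix.diagonalRingHom ι E : (ι → E) →* Matrix ι ι E)).comp
    (MulEquiv.piUnits (M := fun _ : ι => E)).symm.toMonoidHom

theorem val_diagUnits (d : ι → Eˣ) :
    (diagUnits d : Matrix ι ι E) = diagonal fun i => (d i : E) := rfl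

/-- Permutation matrices. -/
def permMatrixHom : Equiv.Perm ι →* Matrix ι ι E where
  toFun σ := of fun p q => if p = σ q then (1 : E) else 0
  map_one' := by ext p q; simp [one_apply]; rfl
  map_mul' σ τ := by ext p q; simp [mul_apply]; rfl

/-- Permutation matrices as units. -/
def permUnits : Equiv.Perm ι →* (Matrix ι ι E)ˣ :=
  MonoidHom.toHomUnits permMatrixHom

theorem val_permUnits (σ : Equiv.Perm ι) :
    (permUnits (E := E) σ : Matrix ι ι E) = of fun p q => if p = σ q then 1 else 0 := rfl

theorem permUnits_mul_mul_inv (σ : Equiv.Perm ι) (B : Matrix ι ι E) :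
    (permUnits (E := E) σ : Matrix ι ι E) * B * ((permUnits (E := E) σ)⁻¹ : (Matrix ι ι E)ˣ) =
      of fun p q => B (σ.symm p) (σ.symm q) := by
  rw [← map_inv, val_permUnits, val_permUnits]
  ext p q
  have hq : ∀ j, (σ j = q) = (j = σ.symm q) := fun j => propext (Equiv.eq_symm_apply σ).symm
  simp [mul_apply, ← Equiv.symm_apply_eq]
  simp only [hq, Finset.sum_ite_eq', Finset.mem_univ, if_true]

theorem permUnits_conj_single (σ : Equiv.Perm ι) (i j : ι) (r : E) :
    (permUnits (E := E) σ : Matrix ι ι E) * single i j r *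
        ((permUnits (E := E) σ)⁻¹ : (Matrix ι ι E)ˣ) =
      single (σ i) (σ j) r := by
  rw [permUnits_mul_mul_inv]
  ext p q
  simp [single_apply, Equiv.eq_symm_apply]

theorem HasUnip.conj_perm {σ : Equiv.Perm ι} (hσ : permUnits σ ∈ K) {i j : ι} {r : E}
    (h : HasUnip K (single i j r)) : HasUnip K (single (σ i) (σ j) r) := by
  obtain ⟨u, hu, hu'⟩ := h
  refine ⟨permUnits σ * u * (permUnits σ)⁻¹, K.mul_mem (K.mul_mem hσ hu) (K.inv_mem hσ), ?_⟩
  rw [Units.val_mul, Units.val_mul, hu', mul_add, add_mul, permUnits_conj_single, mul_one,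
    Units.mul_inv]

theorem matrix_add_self {n : Type*} (h2 : ∀ x : E, x + x = 0) (X : Matrix n n E) : X + X = 0 := by
  ext; exact h2 _

theorem exists_antidiagonal (h2 : ∀ x : E, x + x = 0) {u : Eˣ} (hu : HasElem K (u : E))
    (hu' : HasElem K ((u⁻¹ : Eˣ) : E)) {i j : ι} (hij : i ≠ j) :
    HasUnip K (single i i 1 + single j j 1 + single i j (u : E) +
      single j i ((u⁻¹ : Eˣ) : E)) := by
  obtain ⟨a, ha, ha'⟩ := hu i j hij
  obtain ⟨b, hb, hb'⟩ := hu' j i hij.symm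
  refine ⟨a * b * a, K.mul_mem (K.mul_mem ha hb) ha, ?_⟩
  rw [Units.val_mul, Units.val_mul, ha', hb']
  have e := matrix_add_self h2 (single i j (u : E))
  simp only [mul_add, add_mul, mul_one, one_mul, single_mul_single_same, Units.mul_inv,
    Units.inv_mul, single_mul_eq_zero hij.symm]
  linear_combination (norm := abel) e

theorem diagUnits_mulSingle_mem (h2 : ∀ x : E, x + x = 0) (h1 : HasElem K (1 : E)) {u : Eˣ}
    (hu : HasElem K (u : E)) (hu' : HasElem K ((u⁻¹ : Eˣ) : E)) {i j : ι} (hij : i ≠ j) :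
    diagUnits (Pi.mulSingle i u * Pi.mulSingle j u⁻¹) ∈ K := by
  obtain ⟨a, ha, ha'⟩ := exists_antidiagonal h2 hu hu' hij
  obtain ⟨b, hb, hb'⟩ := exists_antidiagonal h2 (u := 1) h1 (by simpa using h1) hij
  have : diagUnits (Pi.mulSingle i u * Pi.mulSingle j u⁻¹) = a * b := by
    ext1
    rw [Units.val_mul, ha', hb']
    have e1 := matrix_add_self h2 (single i i (1 : E))
    have e2 := matrix_add_self h2 (single j j (1 : E))
    have e3 := matrix_add_self h2 (single i j (1 : E))
    have e4 := matrix_add_self h2 (single j i (1 : E))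
    have e5 := matrix_add_self h2 (single i j (u : E))
    have e6 := matrix_add_self h2 (single j i ((u⁻¹ : Eˣ) : E))
    have e0 : (diagUnits (Pi.mulSingle i u * Pi.mulSingle j u⁻¹) : Matrix ι ι E) =
        1 + single i i 1 + single j j 1 + single i i (u : E) + single j j ((u⁻¹ : Eˣ) : E) := by
      rw [val_diagUnits]
      ext p q
      have hji := hij.symm
      have := h2 1
      by_cases hpq : p = q
      · subst hpq
        by_cases hpi : p = i
        · subst hpi
          simp [hji, hij, this]
        · by_cases hpj : p = j
          · subst hpj
            simp [hji, hij, this]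
          · simp [Ne.symm hpi, Ne.symm hpj, hpi, hpj]
      · simp only [diagonal_apply_ne _ hpq, Matrix.add_apply, one_apply_ne hpq, single_apply]
        grind
    rw [e0]
    simp only [mul_add, add_mul, mul_one, one_mul, single_mul_single_same, Units.val_one, inv_one,
      single_mul_eq_zero hij.symm, single_mul_eq_zero hij]
    linear_combination (norm := abel) - e1 - e2 - e3 - e4 - e5 - e6
  rw [this]
  exact K.mul_mem ha hb

theorem diagUnits_const_commutator_mem (h3 : ∀ i j : ι, ∃ k, k ≠ i ∧ k ≠ j)
    (h2 : ∀ x : E, x + x = 0) (h1 : HasElem K (1 : E)) {u v : Eˣ}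
    (hu : HasElem K (u : E)) (hu' : HasElem K ((u⁻¹ : Eˣ) : E))
    (hv : HasElem K (v : E)) (hv' : HasElem K ((v⁻¹ : Eˣ) : E)) :
    diagUnits (fun _ => u * v * u⁻¹ * v⁻¹) ∈ K := by
  refine Subgroup.pi_mem_of_mulSingle_mem (H := K.comap (diagUnits (ι := ι) (E := E))) _
    fun i => ?_
  obtain ⟨j, hji, -⟩ := h3 i i
  obtain ⟨k, hki, hkj⟩ := h3 i j
  have ha := diagUnits_mulSingle_mem h2 h1 hu hu' hji.symm
  have hb := diagUnits_mulSingle_mem h2 h1 hv hv' hki.symm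
  have := (NormalIn.refl K).commutator_left ha hb
  rw [← map_inv, ← map_inv, ← map_mul, ← map_mul, ← map_mul] at this
  rw [Subgroup.mem_comap]
  convert this using 2
  ext1 l
  by_cases hl : l = i
  · subst hl
    simp [hji.symm, hki.symm]
  · by_cases hlj : l = j
    · subst hlj
      simp [hji, hkj.symm]
    · simp [hl, hlj]

theorem permUnits_mem (h2 : ∀ x : E, x + x = 0) (h1 : HasElem K (1 : E)) (σ : Equiv.Perm ι) :
    permUnits σ ∈ K := by
  induction σ using Equiv.Perm.swap_induction_on with
  | one => rw [map_one]; exact K.one_mem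
  | swap_mul f i j hij ih =>
    rw [map_mul]
    refine K.mul_mem ?_ ih
    obtain ⟨a, ha, ha'⟩ := exists_antidiagonal h2 (u := 1) h1 (by simpa using h1) hij
    suffices permUnits (Equiv.swap i j) = a by rwa [this]
    ext1
    rw [ha', val_permUnits]
    ext p q
    have := h2 1
    simp only [of_apply, Matrix.add_apply, single_apply, Units.val_one, inv_one, one_apply,
      Equiv.swap_apply_def]
    grind

end Monomial

section TwoGenerators

open Matrix

variable {E : Type*} [Ring E] {Q : ℕ}

/-- The number of rows used to encode `Q` ring elements by two matrices. -/
abbrev size (Q : ℕ) : ℕ := 2 * Q ^ 2 + 1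

/-- The matrix with entries `r 0, …, r (Q - 1)` in positions with pairwise distinct differences. -/
def sparse (Q : ℕ) (r : ℕ → E) : Matrix (ZMod (size Q)) (ZMod (size Q)) E :=
  ∑ k ∈ Finset.range Q, single (-(k : ZMod (size Q))) ((Q * k + 1 : ℕ) : ZMod (size Q)) (r k)

theorem natCast_size_ne_zero {x : ℕ} (h0 : 0 < x) (h1 : x < size Q) : (x : ZMod (size Q)) ≠ 0 := by
  rw [Ne, ZMod.natCast_eq_zero_iff]
  exact Nat.not_dvd_of_pos_of_lt h0 h1

theorem position_bound {k : ℕ} (hk : k < Q) : Q * k + Q ≤ Q ^ 2 := by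
  nlinarith

theorem sparse_mul_shift_eq_zero (r s : ℕ → E) {t : ℕ} (ht : t ≤ Q ^ 2) :
    (∑ k ∈ Finset.range Q, single (-(k : ZMod (size Q)) + (t : ℕ))
        (((Q * k + 1 : ℕ) : ZMod (size Q)) + (t : ℕ)) (s k)) * sparse Q r = 0 := by
  rw [sparse, Finset.sum_mul_sum]
  refine Finset.sum_eq_zero fun k hk => Finset.sum_eq_zero fun l hl => single_mul_eq_zero ?_ _ _
  rw [Finset.mem_range] at hk hl
  intro h
  have h' : ((Q * k + 1 + t + l : ℕ) : ZMod (size Q)) = 0 := by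
    push_cast at h ⊢
    linear_combination h
  have := position_bound hk
  refine natCast_size_ne_zero (by omega) ?_ h'
  unfold size
  omega

theorem sparse_sq_zero (r : ℕ → E) : sparse Q r * sparse Q r = 0 := by
  have := sparse_mul_shift_eq_zero (Q := Q) r r (t := 0) (Nat.zero_le _)
  simpa [sparse] using this

theorem sparse_mul_shift (r : ℕ → E) {k₀ l₀ : ℕ} (hk₀ : k₀ < Q) (hl₀ : l₀ < Q) :
    (sparse Q r * ∑ k ∈ Finset.range Q, single (-(k : ZMod (size Q)) + (Q * k₀ + 1 + l₀ : ℕ))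
        (((Q * k + 1 : ℕ) : ZMod (size Q)) + (Q * k₀ + 1 + l₀ : ℕ)) (r k)) =
      single (-(k₀ : ZMod (size Q)))
        (((Q * l₀ + 1 : ℕ) : ZMod (size Q)) + (Q * k₀ + 1 + l₀ : ℕ)) (r k₀ * r l₀) := by
  have key : ∀ k < Q, ∀ l < Q, ((Q * k + 1 : ℕ) : ZMod (size Q)) =
      -(l : ZMod (size Q)) + (Q * k₀ + 1 + l₀ : ℕ) → k = k₀ ∧ l = l₀ := by
    intro k hk l hl h
    have h' : ((Q * k + l : ℕ) : ZMod (size Q)) = (Q * k₀ + l₀ : ℕ) := by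
      push_cast at h ⊢
      linear_combination h
    have b1 := position_bound hk
    have b2 := position_bound hk₀
    rw [ZMod.natCast_eq_natCast_iff', Nat.mod_eq_of_lt (by unfold size; omega),
      Nat.mod_eq_of_lt (by unfold size; omega)] at h'
    have hkk : k = k₀ := by
      have := congrArg (· / Q) h'
      simpa [Nat.mul_add_div (by omega : 0 < Q), Nat.div_eq_of_lt hl, Nat.div_eq_of_lt hl₀]
        using this
    subst hkk
    exact ⟨rfl, by omega⟩
  rw [sparse, Finset.sum_mul_sum, Finset.sum_eq_single k₀, Finset.sum_eq_single l₀]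
  · have : ((Q * k₀ + 1 : ℕ) : ZMod (size Q)) = -(l₀ : ZMod (size Q)) + (Q * k₀ + 1 + l₀ : ℕ) := by
      push_cast; ring
    rw [← this, single_mul_single_same]
  · intro l hl hne
    exact single_mul_eq_zero (fun h => hne (key k₀ hk₀ l (Finset.mem_range.1 hl) h).2) _ _
  · simp [hl₀]
  · intro k hk hne
    exact Finset.sum_eq_zero fun l hl => single_mul_eq_zero
      (fun h => hne (key k (Finset.mem_range.1 hk) l (Finset.mem_range.1 hl) h).1) _ _
  · simp [hk₀]

/-- The cyclic permutation matrix. -/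
def rotUnit (E : Type*) [Ring E] (Q : ℕ) : (Matrix (ZMod (size Q)) (ZMod (size Q)) E)ˣ :=
  permUnits (Equiv.addRight 1)

theorem rotUnit_pow (t : ℕ) : rotUnit E Q ^ t = permUnits (Equiv.addRight (t : ZMod (size Q))) := by
  rw [rotUnit, ← map_pow]
  congr 1
  ext1 i
  induction t with
  | zero => simp
  | succ t ih => rw [pow_succ', Equiv.Perm.mul_apply, ih]; simp [add_assoc]

variable {K : Subgroup (Matrix (ZMod (size Q)) (ZMod (size Q)) E)ˣ}

theorem HasUnip.shift (ha : rotUnit E Q ∈ K) {i j : ZMod (size Q)} {r : E}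
    (h : HasUnip K (single i j r)) (t : ZMod (size Q)) :
    HasUnip K (single (i + t) (j + t) r) := by
  have : permUnits (Equiv.addRight t) ∈ K := by
    have := K.pow_mem ha t.val
    rwa [rotUnit_pow, ZMod.natCast_zmod_val] at this
  exact h.conj_perm this

theorem hasUnip_sparse_product (r : ℕ → E) (ha : rotUnit E Q ∈ K) (hb : HasUnip K (sparse Q r))
    {k l : ℕ} (hk : k < Q) (hl : l < Q) :
    HasUnip K (single (-(k : ZMod (size Q)))
      (((Q * l + 1 : ℕ) : ZMod (size Q)) + (Q * k + 1 + l : ℕ)) (r k * r l)) := by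
  obtain ⟨b, hb, hb'⟩ := hb
  set t := Q * k + 1 + l with ht
  set a := rotUnit E Q ^ t with ha_def
  have hat : a ∈ K := K.pow_mem ha t
  have hv : ((a * b * a⁻¹ : (Matrix (ZMod (size Q)) (ZMod (size Q)) E)ˣ) :
      Matrix (ZMod (size Q)) (ZMod (size Q)) E) = 1 + a * sparse Q r * (a⁻¹ :
        (Matrix (ZMod (size Q)) (ZMod (size Q)) E)ˣ) := by
    rw [Units.val_mul, Units.val_mul, hb', mul_add, add_mul, mul_one, Units.mul_inv]
  have hY : (a : Matrix (ZMod (size Q)) (ZMod (size Q)) E) * sparse Q r * (a⁻¹ :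
        (Matrix (ZMod (size Q)) (ZMod (size Q)) E)ˣ) = ∑ k ∈ Finset.range Q,
          single (-(k : ZMod (size Q)) + (t : ℕ))
            (((Q * k + 1 : ℕ) : ZMod (size Q)) + (t : ℕ)) (r k) := by
    rw [ha_def, rotUnit_pow, sparse, Finset.mul_sum, Finset.sum_mul]
    exact Finset.sum_congr rfl fun k _ => permUnits_conj_single _ _ _ _
  refine ⟨b * (a * b * a⁻¹) * b⁻¹ * (a * b * a⁻¹)⁻¹,
    (NormalIn.refl K).commutator_left hb ((NormalIn.refl K).conj a hat b hb), ?_⟩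
  rw [val_commutator_of_sq_zero hb' hv (sparse_sq_zero r), hY, sparse_mul_shift r hk hl]
  · have hinv := Units.inv_mul a
    revert hinv
    generalize ((a⁻¹ : (Matrix (ZMod (size Q)) (ZMod (size Q)) E)ˣ) :
      Matrix (ZMod (size Q)) (ZMod (size Q)) E) = x
    generalize (a : Matrix (ZMod (size Q)) (ZMod (size Q)) E) = y
    intro hinv
    calc y * sparse Q r * x * (y * sparse Q r * x)
        = y * sparse Q r * (x * y) * sparse Q r * x := by simp only [mul_assoc]
      _ = 0 := by rw [hinv, mul_one, mul_assoc y, sparse_sq_zero, mul_zero, zero_mul]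
  · rw [hY]
    have := position_bound hk
    exact sparse_mul_shift_eq_zero r r (by omega)

theorem isUnit_two : IsUnit (2 : ZMod (size Q)) := by
  refine IsUnit.of_mul_eq_one (-(Q : ZMod (size Q)) ^ 2) ?_
  have : ((size Q : ℕ) : ZMod (size Q)) = 0 := ZMod.natCast_self _
  push_cast at this
  linear_combination -this

theorem hasElem_one_of_sparse (hQ : 0 < Q) (r : ℕ → E) (hr : r 0 = 1) (ha : rotUnit E Q ∈ K)
    (hb : HasUnip K (sparse Q r)) : HasElem K (1 : E) := by
  have h := hasUnip_sparse_product r ha hb hQ hQ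
  simp only [hr, mul_one, Nat.cast_zero, neg_zero, mul_zero, zero_add, add_zero, Nat.cast_one] at h
  have two : ∀ i, HasUnip K (single i (i + 2) (1 : E)) := by
    intro i
    have := h.shift ha i
    rwa [zero_add, one_add_one_eq_two, add_comm] at this
  have even : ∀ m : ℕ, 0 < m → m < size Q →
      ∀ i, HasUnip K (single i (i + 2 * m) (1 : E)) := by
    intro m hm
    induction m, hm using Nat.le_induction with
    | base => intro _ i; simpa using two i
    | succ m hm ih =>
      intro hlt i
      have hne : ∀ x : ℕ, 0 < x → x < size Q → (2 * (x : ZMod (size Q))) ≠ 0 := fun x h0 h1 h =>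
        natCast_size_ne_zero h0 h1 (isUnit_two.mul_right_eq_zero.1 h)
      have e : i + 2 * (m : ZMod (size Q)) + 2 = i + 2 * ((m + 1 : ℕ) : ZMod (size Q)) := by
        push_cast; ring
      have := (ih (by omega) i).mul_left (NormalIn.refl K)
        (fun h => hne m hm (by omega) (by simpa using h.symm))
        (fun h => hne 1 one_pos (by omega) (by simpa using h.symm))
        (fun h => hne (m + 1) (by omega) hlt (by rw [e] at h; simpa using h.symm))
        (two (i + 2 * (m : ZMod (size Q))))
      rwa [e, mul_one] at this
  intro i j hij
  obtain ⟨c, hc⟩ := isUnit_two.dvd (a := j - i)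
  have hc0 : c ≠ 0 := by
    rintro rfl
    exact hij (sub_eq_zero.1 (by simpa using hc)).symm
  have := even c.val (Nat.pos_of_ne_zero (by simpa [ZMod.val_eq_zero] using hc0)) c.val_lt i
  rwa [ZMod.natCast_zmod_val, ← hc, add_sub_cancel] at this

theorem exists_ne_ne (hQ : 0 < Q) (i j : ZMod (size Q)) : ∃ k, k ≠ i ∧ k ≠ j := by
  have : ({i, j} : Finset (ZMod (size Q))).card < (Finset.univ : Finset (ZMod (size Q))).card := by
    refine lt_of_le_of_lt Finset.card_le_two ?_
    rw [Finset.card_univ, ZMod.card]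
    have := pow_pos hQ 2
    unfold size
    omega
  obtain ⟨k, -, hk⟩ := Finset.exists_mem_notMem_of_card_lt_card this
  exact ⟨k, by simpa using hk⟩

theorem hasElem_of_sparse (hQ : 0 < Q) (r : ℕ → E) (hr : r 0 = 1) (ha : rotUnit E Q ∈ K)
    (hb : HasUnip K (sparse Q r)) {k : ℕ} (hk : k < Q) : HasElem K (r k) := by
  have h := hasUnip_sparse_product r ha hb hk hQ
  rw [hr, mul_one] at h
  refine h.hasElem (exists_ne_ne hQ) (NormalIn.refl K) (hasElem_one_of_sparse hQ r hr ha hb) ?_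
  intro e
  have : ((k + (Q * k + 2) : ℕ) : ZMod (size Q)) = 0 := by
    push_cast at e ⊢
    linear_combination -e
  have b := position_bound hk
  have b' : Q ≤ Q ^ 2 := by nlinarith
  refine natCast_size_ne_zero (by omega) ?_ this
  unfold size
  omega

theorem hasUnip_sparse {r : ℕ → E} (h : ∀ k < Q, HasElem K (r k)) : HasUnip K (sparse Q r) := by
  suffices ∀ m ≤ Q, HasUnip K (∑ k ∈ Finset.range m,
      single (-(k : ZMod (size Q))) ((Q * k + 1 : ℕ) : ZMod (size Q)) (r k)) from this Q le_rfl
  have off : ∀ k < Q, ∀ l < Q, ((Q * k + 1 : ℕ) : ZMod (size Q)) ≠ -(l : ZMod (size Q)) := by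
    intro k hk l hl e
    have e' : ((Q * k + 1 + l : ℕ) : ZMod (size Q)) = 0 := by
      push_cast at e ⊢
      linear_combination e
    have := position_bound hk
    refine natCast_size_ne_zero (by omega) ?_ e'
    unfold size
    omega
  intro m hm
  induction m with
  | zero => exact ⟨1, K.one_mem, by simp⟩
  | succ m ih =>
    obtain ⟨u, hu, hu'⟩ := ih (by omega)
    obtain ⟨v, hv, hv'⟩ := h m hm _ _ (off m hm m hm).symm
    refine ⟨u * v, K.mul_mem hu hv, ?_⟩
    have hz : (∑ k ∈ Finset.range m, single (-(k : ZMod (size Q)))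
        ((Q * k + 1 : ℕ) : ZMod (size Q)) (r k)) *
          single (-(m : ZMod (size Q))) ((Q * m + 1 : ℕ) : ZMod (size Q)) (r m) = 0 := by
      rw [Finset.sum_mul]
      exact Finset.sum_eq_zero fun k hk =>
        single_mul_eq_zero (off k (lt_trans (Finset.mem_range.1 hk) hm) m hm) _ _
    rw [Units.val_mul, hu', hv', Finset.sum_range_succ, mul_add, mul_one, add_mul, one_mul, hz,
      add_zero, add_assoc]

end TwoGenerators

section WordMetric

variable {H : Type*} [Group H] {A : Set H}

theorem wordDist_eq (g h : H) : wordDist A g h = wordDist A 1 (g⁻¹ * h) := by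
  simp [wordDist]

theorem wordDist_le {w : List H} (hw : ∀ x ∈ w, x ∈ A ∨ x⁻¹ ∈ A) :
    wordDist A 1 w.prod ≤ w.length :=
  Nat.sInf_le ⟨w, hw, rfl, by simp⟩

theorem exists_word (hA : Subgroup.closure A = ⊤) (g : H) :
    ∃ w : List H, (∀ x ∈ w, x ∈ A ∨ x⁻¹ ∈ A) ∧ w.length = wordDist A 1 g ∧ w.prod = g := by
  have hne : {n | ∃ w : List H, (∀ x ∈ w, x ∈ A ∨ x⁻¹ ∈ A) ∧ w.length = n ∧
      w.prod = 1⁻¹ * g}.Nonempty := by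
    have hg : g ∈ (Subgroup.closure A).toSubmonoid := by simp [hA]
    rw [Subgroup.closure_toSubmonoid] at hg
    obtain ⟨w, hw, hg⟩ := Submonoid.exists_list_of_mem_closure hg
    exact ⟨w.length, w, hw, rfl, by simpa using hg⟩
  simpa [wordDist] using Nat.sInf_mem hne

theorem wordDist_one_one : wordDist A 1 1 = 0 :=
  Nat.le_zero.1 (wordDist_le (A := A) (w := []) (by simp))

theorem wordDist_le_one {a : H} (ha : a ∈ A) : wordDist A 1 a ≤ 1 := by
  simpa using wordDist_le (A := A) (w := [a]) (by simpa using Or.inl ha)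

theorem wordDist_mul_le (hA : Subgroup.closure A = ⊤) (g h : H) :
    wordDist A 1 (g * h) ≤ wordDist A 1 g + wordDist A 1 h := by
  obtain ⟨v, hv, hvl, hvg⟩ := exists_word hA g
  obtain ⟨w, hw, hwl, hwh⟩ := exists_word hA h
  have := wordDist_le (A := A) (w := v ++ w) fun x hx => (List.mem_append.1 hx).elim (hv x) (hw x)
  rwa [List.prod_append, List.length_append, hvl, hwl, hvg, hwh] at this

theorem wordDist_inv_le (hA : Subgroup.closure A = ⊤) (g : H) :
    wordDist A 1 g⁻¹ ≤ wordDist A 1 g := by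
  obtain ⟨w, hw, hwl, hwg⟩ := exists_word hA g
  have := wordDist_le (A := A) (w := (w.map (·⁻¹)).reverse) fun x hx => by
    obtain ⟨y, hy, rfl⟩ := List.mem_map.1 (List.mem_reverse.1 hx)
    simpa [or_comm] using hw y hy
  rwa [← List.prod_inv_reverse, List.length_reverse, List.length_map, hwl, hwg] at this

/-- A homomorphism is Lipschitz if it is bounded on the generators. -/
theorem wordDist_map_le {G : Type*} [Group G] {S : Set G} (hS : Subgroup.closure S = ⊤)
    (hA : Subgroup.closure A = ⊤) (φ : G →* H) {C : ℕ} (hC : ∀ s ∈ S, wordDist A 1 (φ s) ≤ C)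
    (g : G) : wordDist A 1 (φ g) ≤ C * wordDist S 1 g := by
  obtain ⟨w, hw, hwl, rfl⟩ := exists_word hS g
  rw [← hwl]
  clear hwl
  induction w with
  | nil => simp [wordDist_one_one]
  | cons x w ih =>
    rw [List.prod_cons, map_mul, List.length_cons, mul_add_one, add_comm]
    refine (wordDist_mul_le hA _ _).trans (add_le_add ?_ (ih fun y hy => hw y (by simp [hy])))
    rcases hw x (by simp) with hx | hx
    · exact hC x hx
    · have := wordDist_inv_le hA (φ x⁻¹)
      rw [← map_inv, inv_inv] at this
      exact this.trans (hC _ hx)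

end WordMetric

/-- If every normal subgroup containing `e ≠ 1` is the whole group, then some quotient in which `e`
survives is simple. -/
theorem exists_isSimpleGroup_quotient {K : Type*} [Group K] {e : K} (he : e ≠ 1)
    (htop : ∀ N : Subgroup K, N.Normal → e ∈ N → N = ⊤) :
    ∃ N : Subgroup K, ∃ _ : N.Normal, e ∉ N ∧ IsSimpleGroup (K ⧸ N) := by
  obtain ⟨N, -, ⟨hN, heN⟩, hmax⟩ := zorn_le_nonempty₀ {N : Subgroup K | N.Normal ∧ e ∉ N}
    (fun c hc hchain y hy => by
      have hmem : ∀ {x}, x ∈ sSup c ↔ ∃ N ∈ c, x ∈ N := fun {x} =>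
        Subgroup.mem_sSup_of_directedOn ⟨y, hy⟩ hchain.directedOn
      refine ⟨sSup c, ⟨⟨fun n hn g => ?_⟩, fun h => ?_⟩, fun z hz => le_sSup hz⟩
      · obtain ⟨N, hN, hnN⟩ := hmem.1 hn
        exact hmem.2 ⟨N, hN, (hc hN).1.conj_mem n hnN g⟩
      · obtain ⟨N, hN, heN⟩ := hmem.1 h
        exact (hc hN).2 heN)
    ⊥ ⟨inferInstance, by simpa using he⟩
  refine ⟨N, hN, heN, ?_⟩
  have : Nontrivial (K ⧸ N) :=
    ⟨⟨(e : K ⧸ N), 1, fun h => heN ((QuotientGroup.eq_one_iff e).1 h)⟩⟩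
  refine ⟨fun L hL => ?_⟩
  have hinj := Subgroup.comap_injective (QuotientGroup.mk'_surjective N)
  have hle : N ≤ L.comap (QuotientGroup.mk' N) := by
    intro x hx
    rw [Subgroup.mem_comap, QuotientGroup.mk'_apply, (QuotientGroup.eq_one_iff x).2 hx]
    exact L.one_mem
  by_cases heL : e ∈ L.comap (QuotientGroup.mk' N)
  · right
    apply hinj
    rw [htop _ (hL.comap _) heL, Subgroup.comap_top]
  · left
    apply hinj
    rw [MonoidHom.comap_bot, QuotientGroup.ker_mk']
    exact le_antisymm (hmax ⟨hL.comap _, heL⟩ hle) hle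

section Operators

/-- The ring of additive operators on `ZMod 2`-valued functions. -/
abbrev FunEnd (Y : Type*) := AddMonoid.End (Y → ZMod 2)

theorem funEnd_add_self {Y : Type*} (T : FunEnd Y) : T + T = 0 := by
  ext f q
  exact CharTwo.add_self_eq_zero _

theorem funEnd_mul_apply {Y : Type*} (S T : FunEnd Y) (f : Y → ZMod 2) : (S * T) f = S (T f) :=
  rfl

/-- Operators whose output at a point depends only on the input at points where the value of `κ`
differs by at most `m`. -/
def fil {Y : Type*} (κ : Y → ℕ) (m : ℕ) : AddSubmonoid (FunEnd Y) where
  carrier := {T | ∀ f q, (∀ q', κ q ≤ κ q' + m → κ q' ≤ κ q + m → f q' = 0) → T f q = 0}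
  zero_mem' := fun _ _ _ => rfl
  add_mem' := fun {S T} hS hT f q h => by
    change S f q + T f q = 0
    rw [hS f q h, hT f q h, add_zero]

section Filtration

variable {Y : Type*} {κ : Y → ℕ}

theorem one_mem_fil (m : ℕ) : (1 : FunEnd Y) ∈ fil κ m :=
  fun _ q h => h q (by omega) (by omega)

theorem mul_mem_fil {m n : ℕ} {S T : FunEnd Y} (hS : S ∈ fil κ m) (hT : T ∈ fil κ n) :
    S * T ∈ fil κ (m + n) := fun f q h =>
  hS (T f) q fun q' h1 h2 => hT f q' fun q'' h3 h4 => h q'' (by omega) (by omega)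

open Matrix

variable {ι : Type*} [Fintype ι] [DecidableEq ι]

theorem prod_entries_mem_fil {w : List (Matrix ι ι (FunEnd Y))ˣ}
    (hw : ∀ u ∈ w, ∀ i j, (u : Matrix ι ι (FunEnd Y)) i j ∈ fil κ 1 ∧
      ((u⁻¹ : (Matrix ι ι (FunEnd Y))ˣ) : Matrix ι ι (FunEnd Y)) i j ∈ fil κ 1) (i j : ι) :
    (w.prod : Matrix ι ι (FunEnd Y)) i j ∈ fil κ w.length ∧
      ((w.prod⁻¹ : (Matrix ι ι (FunEnd Y))ˣ) : Matrix ι ι (FunEnd Y)) i j ∈ fil κ w.length := by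
  induction w generalizing i j with
  | nil =>
    simp only [List.prod_nil, Units.val_one, inv_one, and_self, one_apply]
    split_ifs
    · exact one_mem_fil _
    · exact zero_mem _
  | cons u w ih =>
    have ih := ih fun v hv => hw v (List.mem_cons_of_mem _ hv)
    have hu := hw u List.mem_cons_self
    rw [List.prod_cons, _root_.mul_inv_rev, Units.val_mul, Units.val_mul, mul_apply, mul_apply,
      List.length_cons]
    refine ⟨?_, sum_mem fun k _ => mul_mem_fil (ih i k).2 (hu k j).2⟩
    rw [add_comm]
    exact sum_mem fun k _ => mul_mem_fil (hu i k).1 (ih k j).1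

end Filtration

variable {X : Type*}

/-- The action of a permutation of the alphabet on the first letter of a word. -/
def headMap (π : X → X) : List X → List X
  | [] => []
  | h :: t => π h :: t

theorem headMap_headMap (π τ : X → X) (q : List X) :
    headMap π (headMap τ q) = headMap (π ∘ τ) q := by
  cases q <;> rfl

theorem headMap_id (q : List X) : headMap id q = q := by
  cases q <;> rfl

/-- The operator induced by a permutation of the alphabet acting on first letters. -/
def headHom : Equiv.Perm X →* FunEnd (List X) where
  toFun π :=
    { toFun := fun f q => f (headMap π.symm q)
      map_zero' := rfl
      map_add' := fun _ _ => rfl }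
  map_one' := by
    ext f q
    exact congrArg f (headMap_id q)
  map_mul' π τ := by
    ext f q
    exact congrArg f (headMap_headMap τ.symm π.symm q).symm

theorem headHom_apply (π : Equiv.Perm X) (f : List X → ZMod 2) (q : List X) :
    headHom π f q = f (headMap π.symm q) :=
  rfl

/-- Units induced by permutations of the alphabet. -/
def headUnits : Equiv.Perm X →* (FunEnd (List X))ˣ :=
  (headHom (X := X)).toHomUnits

theorem val_headUnits (π : Equiv.Perm X) : (headUnits π : FunEnd (List X)) = headHom π :=
  rfl

variable (c : X)

/-- Restricts functions to the words with first letter `c`. -/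
def pop : FunEnd (List X) where
  toFun f q := f (c :: q)
  map_zero' := rfl
  map_add' _ _ := rfl

theorem pop_pow_apply (N : ℕ) (f : List X → ZMod 2) (q : List X) :
    (pop c ^ N) f q = f (List.replicate N c ++ q) := by
  induction N generalizing q with
  | zero => rfl
  | succ N ih =>
    rw [pow_succ', funEnd_mul_apply]
    refine (ih (c :: q)).trans ?_
    rw [List.replicate_succ', List.append_assoc, List.singleton_append]

variable [DecidableEq X]

/-- Transports functions to the words with first letter `c`. -/
def push : FunEnd (List X) where
  toFun f
    | [] => 0
    | h :: t => if h = c then f t else 0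
  map_zero' := by
    ext q
    cases q <;> simp
  map_add' f g := by
    ext q
    cases q
    · simp
    · simp only [Pi.add_apply]
      split_ifs <;> simp

theorem push_nil (f : List X → ZMod 2) : push c f [] = 0 :=
  rfl

theorem push_cons (f : List X → ZMod 2) (h : X) (t : List X) :
    push c f (h :: t) = if h = c then f t else 0 :=
  rfl

theorem pop_mul_push : pop c * push c = 1 := by
  ext f q
  exact if_pos rfl

theorem exists_of_push_pow_ne_zero {N : ℕ} {f : List X → ZMod 2} {q : List X}
    (h : (push c ^ N) f q ≠ 0) : ∃ r, q = List.replicate N c ++ r := by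
  induction N generalizing q with
  | zero => exact ⟨q, rfl⟩
  | succ N ih =>
    rw [pow_succ', funEnd_mul_apply] at h
    cases q with
    | nil => exact absurd (push_nil c _) h
    | cons x t =>
      rw [push_cons] at h
      split_ifs at h with hx
      · obtain ⟨r, rfl⟩ := ih h
        exact ⟨r, by rw [hx, List.replicate_succ, List.cons_append]⟩
      · exact absurd rfl h

/-- If `T` does not move points between the image under `π` of the words starting with `c ^ N` and
the words starting with `c ^ N`, then `T` composed with `π` displaces the latter. -/
theorem displacement {N m : ℕ} {κ : List X → ℕ} {π : Equiv.Perm X} (hm : m < N)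
    (h0 : ∀ r, κ (List.replicate N c ++ r) = 0)
    (hN : ∀ r, κ (headMap π (List.replicate N c ++ r)) = N) {T : FunEnd (List X)}
    (hT : T ∈ fil κ m) :
    pop c ^ N * (headHom π⁻¹ * T) * push c ^ N = 0 ∧
      pop c ^ N * (T * headHom π) * push c ^ N = 0 := by
  constructor
  · ext f q
    simp only [funEnd_mul_apply, pop_pow_apply, headHom_apply]
    refine hT _ _ fun q' h1 _ => ?_
    by_contra hne
    obtain ⟨r, rfl⟩ := exists_of_push_pow_ne_zero c hne
    have := hN q
    rw [h0] at h1
    change κ (headMap π _) ≤ _ at h1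
    omega
  · ext f q
    simp only [funEnd_mul_apply, pop_pow_apply]
    refine hT _ _ fun q' _ h2 => ?_
    rw [headHom_apply]
    by_contra hne
    obtain ⟨r, hr⟩ := exists_of_push_pow_ne_zero c hne
    have := hN r
    rw [← hr, headMap_headMap, Equiv.self_comp_symm, headMap_id] at this
    rw [h0] at h2
    omega

end Operators

section Weights

variable {G : Type*} [Group G]

/-- The largest of the lengths of the group elements among the first `N` letters, where the
contribution of later letters is truncated more severely. -/
noncomputable def weight (A : Set G) : ℕ → List (ℤ × G) → ℕ
  | 0, _ => 0
  | _ + 1, [] => 0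
  | N + 1, h :: t => max (min (wordDist A 1 h.2) (N + 1)) (weight A N t)

variable {A : Set G}

theorem weight_le_succ (N : ℕ) (q : List (ℤ × G)) :
    weight A N q ≤ weight A (N + 1) q ∧ weight A (N + 1) q ≤ weight A N q + 1 := by
  induction N generalizing q with
  | zero => cases q <;> simp [weight]
  | succ N ih =>
    cases q with
    | nil => simp [weight]
    | cons h t =>
      have := ih t
      rw [weight, weight]
      omega

theorem weight_cons_one (N : ℕ) (n : ℤ) (t : List (ℤ × G)) :
    weight A (N + 1) ((n, 1) :: t) = weight A N t := by
  simp [weight, wordDist_one_one]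

theorem weight_replicate (N : ℕ) (n : ℤ) (r : List (ℤ × G)) :
    weight A N (List.replicate N (n, 1) ++ r) = 0 := by
  induction N with
  | zero => rfl
  | succ N ih => rw [List.replicate_succ, List.cons_append, weight_cons_one, ih]

theorem weight_headMap_replicate {N : ℕ} {g : G} (hg : wordDist A 1 g = N) {n m : ℤ}
    {π : ℤ × G → ℤ × G} (hπ : π (n, 1) = (m, g)) (r : List (ℤ × G)) :
    weight A N (headMap π (List.replicate N (n, 1) ++ r)) = N := by
  cases N with
  | zero => rfl
  | succ N => simp [List.replicate_succ, headMap, hπ, weight, hg, weight_replicate]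

variable (n : ℤ) (N : ℕ)

theorem push_mem_fil [DecidableEq (ℤ × G)] : push ((n, 1) : ℤ × G) ∈ fil (weight A N) 1 := by
  intro f q hf
  cases q with
  | nil => rfl
  | cons h t =>
    rw [push_cons]
    split_ifs with hh
    · subst hh
      refine hf t ?_ ?_ <;> cases N with
      | zero => simp [weight]
      | succ N =>
        have := weight_le_succ (A := A) N t
        rw [weight_cons_one]
        omega
    · rfl

theorem pop_mem_fil : pop ((n, 1) : ℤ × G) ∈ fil (weight A N) 1 := by
  intro f q hf
  refine hf _ ?_ ?_ <;> cases N with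
  | zero => simp [weight]
  | succ N =>
    have := weight_le_succ (A := A) N q
    rw [weight_cons_one]
    omega

theorem headHom_mem_fil {π : Equiv.Perm (ℤ × G)}
    (hπ : ∀ p, wordDist A 1 (π p).2 ≤ wordDist A 1 p.2 + 1 ∧
      wordDist A 1 p.2 ≤ wordDist A 1 (π p).2 + 1) : headHom π ∈ fil (weight A N) 1 := by
  intro f q hf
  refine hf _ ?_ ?_ <;> cases N with
  | zero => simp [weight]
  | succ N =>
    cases q with
    | nil => simp [weight, headMap]
    | cons h t =>
      have := hπ (π.symm h)
      rw [Equiv.apply_symm_apply] at this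
      rw [headMap, weight, weight]
      omega

end Weights

section AlphabetPermutations

variable (G : Type*) [Group G]

/-- The shift of the integer coordinate. -/
def shiftPerm : Equiv.Perm (ℤ × G) :=
  (Equiv.addRight 1).prodCongr (Equiv.refl G)

variable {G}

/-- Left multiplication on the fibres over the integers in `s`. -/
def fibreMul (s : ℤ → Prop) [DecidablePred s] : G →* Equiv.Perm (ℤ × G) where
  toFun g :=
    { toFun := fun p => (p.1, if s p.1 then g * p.2 else p.2)
      invFun := fun p => (p.1, if s p.1 then g⁻¹ * p.2 else p.2)
      left_inv := fun p => by by_cases h : s p.1 <;> simp [h]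
      right_inv := fun p => by by_cases h : s p.1 <;> simp [h] }
  map_one' := by ext p <;> simp
  map_mul' g h := by
    ext p
    · simp
    · by_cases h : s p.1 <;> simp [h, mul_assoc]

theorem fibreMul_apply (s : ℤ → Prop) [DecidablePred s] (g : G) (p : ℤ × G) :
    fibreMul s g p = (p.1, if s p.1 then g * p.2 else p.2) :=
  rfl

theorem fibreMul_eq_commutator (g : G) :
    fibreMul (· = 0) g = fibreMul (0 ≤ ·) g * shiftPerm G * (fibreMul (0 ≤ ·) g)⁻¹ *
      (shiftPerm G)⁻¹ := by
  rw [← map_inv, eq_mul_inv_iff_mul_eq, map_inv, eq_mul_inv_iff_mul_eq]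
  ext ⟨n, x⟩
  · simp [fibreMul_apply, shiftPerm]
  · simp only [fibreMul_apply, shiftPerm, Equiv.Perm.mul_apply, Equiv.prodCongr_apply, Prod.map,
      Equiv.coe_addRight, Equiv.refl_apply]
    split_ifs <;> first | rfl | omega

end AlphabetPermutations

section Ambient

open Matrix

variable {Y : Type*} {Q : ℕ}

/-- The involution `1 + sparse Q r` in characteristic two. -/
def sparseUnit (Q : ℕ) (r : ℕ → FunEnd Y) :
    (Matrix (ZMod (size Q)) (ZMod (size Q)) (FunEnd Y))ˣ :=
  have h : (1 + sparse Q r) * (1 + sparse Q r) = 1 := by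
    rw [mul_add, mul_one, add_mul, one_mul, sparse_sq_zero, add_zero, add_assoc,
      matrix_add_self funEnd_add_self, add_zero]
  ⟨1 + sparse Q r, 1 + sparse Q r, h, h⟩

/-- The group generated by the cyclic permutation matrix and the sparse involution. -/
def twoGen (Q : ℕ) (r : ℕ → FunEnd Y) :
    Subgroup (Matrix (ZMod (size Q)) (ZMod (size Q)) (FunEnd Y))ˣ :=
  Subgroup.closure {rotUnit (FunEnd Y) Q, sparseUnit Q r}

variable {r : ℕ → FunEnd Y}

theorem rotUnit_mem_twoGen : rotUnit (FunEnd Y) Q ∈ twoGen Q r :=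
  Subgroup.subset_closure (Or.inl rfl)

theorem hasUnip_sparse_twoGen : HasUnip (twoGen Q r) (sparse Q r) :=
  ⟨sparseUnit Q r, Subgroup.subset_closure (Or.inr rfl), rfl⟩

theorem hasElem_twoGen (hQ : 0 < Q) (hr : r 0 = 1) {k : ℕ} (hk : k < Q) :
    HasElem (twoGen Q r) (r k) :=
  hasElem_of_sparse hQ r hr rotUnit_mem_twoGen hasUnip_sparse_twoGen hk

theorem hasElem_one_twoGen (hQ : 0 < Q) (hr : r 0 = 1) : HasElem (twoGen Q r) (1 : FunEnd Y) :=
  hr ▸ hasElem_twoGen hQ hr hQ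

theorem twoGen_le_of_hasElem_one (hQ : 0 < Q) (hr : r 0 = 1)
    {M : Subgroup (Matrix (ZMod (size Q)) (ZMod (size Q)) (FunEnd Y))ˣ}
    (hM : NormalIn M (twoGen Q r)) (h1 : HasElem M (1 : FunEnd Y)) : twoGen Q r ≤ M := by
  rw [twoGen, Subgroup.closure_le]
  rintro u (rfl | rfl)
  · exact permUnits_mem funEnd_add_self h1 _
  · obtain ⟨u, hu, hu'⟩ := hasUnip_sparse fun k hk =>
      h1.of_one (exists_ne_ne hQ) hM (hasElem_twoGen hQ hr hk)
    have : u = sparseUnit Q r := Units.ext hu'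
    exact this ▸ hu

theorem generator_entries_mem_fil {κ : Y → ℕ} (hκ : ∀ k < Q, r k ∈ fil κ 1)
    {u : (Matrix (ZMod (size Q)) (ZMod (size Q)) (FunEnd Y))ˣ}
    (hu : u ∈ ({rotUnit (FunEnd Y) Q, sparseUnit Q r} : Set _)) (i j : ZMod (size Q)) :
    (u : Matrix (ZMod (size Q)) (ZMod (size Q)) (FunEnd Y)) i j ∈ fil κ 1 ∧
      ((u⁻¹ : (Matrix (ZMod (size Q)) (ZMod (size Q)) (FunEnd Y))ˣ) :
        Matrix (ZMod (size Q)) (ZMod (size Q)) (FunEnd Y)) i j ∈ fil κ 1 := by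
  have perm : ∀ σ : Equiv.Perm (ZMod (size Q)), ((permUnits σ :
      (Matrix (ZMod (size Q)) (ZMod (size Q)) (FunEnd Y))ˣ) :
        Matrix (ZMod (size Q)) (ZMod (size Q)) (FunEnd Y)) i j ∈ fil κ 1 := by
    intro σ
    rw [val_permUnits, of_apply]
    split_ifs
    · exact one_mem_fil 1
    · exact zero_mem _
  obtain rfl | rfl := hu
  · rw [rotUnit, ← map_inv]
    exact ⟨perm _, perm _⟩
  · suffices (1 + sparse Q r) i j ∈ fil κ 1 from ⟨this, this⟩
    rw [Matrix.add_apply, sparse, Matrix.sum_apply, one_apply]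
    refine add_mem ?_ (sum_mem fun k hk => ?_)
    · split_ifs
      · exact one_mem_fil 1
      · exact zero_mem _
    · rw [single_apply]
      split_ifs
      · exact hκ k (Finset.mem_range.1 hk)
      · exact zero_mem _

theorem word_entries_mem_fil {κ : Y → ℕ} (hκ : ∀ k < Q, r k ∈ fil κ 1)
    {w : List (Matrix (ZMod (size Q)) (ZMod (size Q)) (FunEnd Y))ˣ}
    (hw : ∀ u ∈ w, u ∈ ({rotUnit (FunEnd Y) Q, sparseUnit Q r} : Set _) ∨
      u⁻¹ ∈ ({rotUnit (FunEnd Y) Q, sparseUnit Q r} : Set _)) (i j : ZMod (size Q)) :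
    (w.prod : Matrix (ZMod (size Q)) (ZMod (size Q)) (FunEnd Y)) i j ∈ fil κ w.length ∧
      ((w.prod⁻¹ : (Matrix (ZMod (size Q)) (ZMod (size Q)) (FunEnd Y))ˣ) :
        Matrix (ZMod (size Q)) (ZMod (size Q)) (FunEnd Y)) i j ∈ fil κ w.length := by
  refine prod_entries_mem_fil (fun u hu i j => ?_) i j
  rcases hw u hu with h | h
  · exact generator_entries_mem_fil hκ h i j
  · have := generator_entries_mem_fil hκ h i j
    rw [inv_inv] at this
    exact this.symm

end Ambient

section Embedding

open Matrix

variable {G : Type*} [Group G] [DecidableEq G]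

/-- The operators encoded in the sparse matrix for a group with generators listed in `L`. -/
def operators (L : List G) : List (FunEnd (List (ℤ × G))) :=
  [1, push (0, 1), pop (0, 1), headHom (shiftPerm G), headHom (shiftPerm G)⁻¹] ++
    L.map (fun g => headHom (fibreMul (0 ≤ ·) g)) ++
    L.map (fun g => headHom (fibreMul (0 ≤ ·) g)⁻¹)

theorem operators_mem_fil {L : List G} (hL : Subgroup.closure {g | g ∈ L} = ⊤) (N : ℕ)
    {T : FunEnd (List (ℤ × G))} (hT : T ∈ operators L) : T ∈ fil (weight {g | g ∈ L} N) 1 := by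
  have mul : ∀ g x : G, wordDist {g | g ∈ L} 1 g ≤ 1 → wordDist {g | g ∈ L} 1 (g * x) ≤
      wordDist {g | g ∈ L} 1 x + 1 ∧ wordDist {g | g ∈ L} 1 x ≤
        wordDist {g | g ∈ L} 1 (g * x) + 1 := by
    intro g x hg
    have h1 := wordDist_mul_le hL g x
    have h2 := wordDist_mul_le hL g⁻¹ (g * x)
    have h3 := wordDist_inv_le hL g
    rw [inv_mul_cancel_left] at h2
    omega
  have fib : ∀ g, wordDist {g | g ∈ L} 1 g ≤ 1 →
      headHom (fibreMul (0 ≤ ·) g) ∈ fil (weight {g | g ∈ L} N) 1 := by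
    intro g hg
    refine headHom_mem_fil N fun p => ?_
    rw [fibreMul_apply]
    split_ifs
    · exact mul g p.2 hg
    · exact ⟨Nat.le_succ _, Nat.le_succ _⟩
  simp only [operators, List.mem_append, List.mem_cons, List.mem_map, List.not_mem_nil,
    or_false] at hT
  rcases hT with ((rfl | rfl | rfl | rfl | rfl) | ⟨g, hg, rfl⟩) | ⟨g, hg, rfl⟩
  · exact one_mem_fil 1
  · exact push_mem_fil 0 N
  · exact pop_mem_fil 0 N
  · exact headHom_mem_fil N fun p => ⟨Nat.le_succ _, Nat.le_succ _⟩
  · exact headHom_mem_fil N fun p => ⟨Nat.le_succ _, Nat.le_succ _⟩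
  · exact fib g (wordDist_le_one hg)
  · rw [← map_inv (fibreMul _)]
    exact fib g⁻¹ ((wordDist_inv_le hL g).trans (wordDist_le_one hg))

theorem operators_length_pos (L : List G) : 0 < (operators L).length := by
  simp [operators]

/-- The two-generated group of matrices associated to generators listed in `L`. -/
abbrev matGroup (L : List G) :=
  twoGen (operators L).length fun k => (operators L).getD k 0

theorem getD_operators_zero (L : List G) : (operators L).getD 0 0 = 1 :=
  rfl

theorem hasElem_one_matGroup (L : List G) : HasElem (matGroup L) (1 : FunEnd (List (ℤ × G))) :=
  hasElem_one_twoGen (operators_length_pos L) (getD_operators_zero L)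

theorem hasElem_matGroup {L : List G} {T : FunEnd (List (ℤ × G))} (hT : T ∈ operators L) :
    HasElem (matGroup L) T := by
  obtain ⟨k, hk, rfl⟩ := List.mem_iff_getElem.1 hT
  rw [← List.getD_eq_getElem _ 0 hk]
  exact hasElem_twoGen (r := fun k => (operators L).getD k 0) (operators_length_pos L)
    (getD_operators_zero L) hk

/-- The diagonal embedding of `G` acting on first letters over the integer zero. -/
def diagHom (L : List G) : G →* (Matrix (ZMod (size (operators L).length))
    (ZMod (size (operators L).length)) (FunEnd (List (ℤ × G))))ˣ :=
  diagUnits.comp (MonoidHom.pi fun _ => headUnits.comp (fibreMul (· = 0)))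

theorem diagHom_mem {L : List G} (hL : Subgroup.closure {g | g ∈ L} = ⊤) (g : G) :
    diagHom L g ∈ matGroup L := by
  suffices ⊤ ≤ (matGroup L).comap (diagHom L) from this (Subgroup.mem_top g)
  rw [← hL, Subgroup.closure_le]
  intro a ha
  change diagUnits (fun _ => headUnits (fibreMul (· = 0) a)) ∈ matGroup L
  rw [fibreMul_eq_commutator, map_mul, map_mul, map_mul, map_inv, map_inv]
  have mem : ∀ T, T ∈ operators L → HasElem (matGroup L) T := fun T => hasElem_matGroup
  refine diagUnits_const_commutator_mem (exists_ne_ne (operators_length_pos L)) funEnd_add_self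
    (hasElem_one_matGroup L) (mem _ ?_) (mem _ ?_) (mem _ ?_) (mem _ ?_)
  · exact List.mem_append_left _ (List.mem_append_right _ (List.mem_map_of_mem ha))
  · rw [← map_inv]
    exact List.mem_append_right _ (List.mem_map_of_mem ha)
  · simp [operators, val_headUnits]
  · rw [← map_inv, val_headUnits]
    simp [operators]

/-- A normal subgroup of the matrix group that identifies a short word with the image of a long
element of `G` contains the elementary matrices. -/
theorem hasElem_one_of_length_lt {L : List G} (hL : Subgroup.closure {g | g ∈ L} = ⊤)
    {M : Subgroup (Matrix (ZMod (size (operators L).length)) (ZMod (size (operators L).length))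
      (FunEnd (List (ℤ × G))))ˣ} (hM : NormalIn M (matGroup L)) {g : G}
    {w : List (Matrix (ZMod (size (operators L).length)) (ZMod (size (operators L).length))
      (FunEnd (List (ℤ × G))))ˣ}
    (hw : ∀ u ∈ w, u ∈ ({rotUnit _ _, sparseUnit _ fun k => (operators L).getD k 0} : Set _) ∨
      u⁻¹ ∈ ({rotUnit _ _, sparseUnit _ fun k => (operators L).getD k 0} : Set _))
    (hlt : w.length < wordDist {g | g ∈ L} 1 g) (hg : (diagHom L g)⁻¹ * w.prod ∈ M) :
    HasElem M (1 : FunEnd (List (ℤ × G))) := by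
  set N := wordDist {g | g ∈ L} 1 g with hN
  have h3 := exists_ne_ne (operators_length_pos L)
  have h1 := hasElem_one_matGroup L
  have hx : HasElem (matGroup L) (pop ((0 : ℤ), (1 : G))) := hasElem_matGroup (by simp [operators])
  have hy : HasElem (matGroup L) (push ((0 : ℤ), (1 : G))) :=
    hasElem_matGroup (by simp [operators])
  have hfil : ∀ k < (operators L).length,
      (operators L).getD k 0 ∈ fil (weight {g | g ∈ L} N) 1 := by
    intro k hk
    rw [List.getD_eq_getElem _ 0 hk]
    exact operators_mem_fil hL N (List.getElem_mem hk)
  have hent := word_entries_mem_fil (r := fun k => (operators L).getD k 0) hfil hw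
  have hdis := fun {T} => displacement ((0 : ℤ), (1 : G)) hlt (weight_replicate N 0)
    (weight_headMap_replicate hN.symm (n := 0) (m := 0) (π := fibreMul (· = 0) g)
      (by simp [fibreMul_apply]))
    (T := T)
  refine hM.hasElem_one_of_displacement h3 h1 (.pow h3 h1 hx N) (.pow h3 h1 hy N)
    (pow_mul_pow_eq_one N (pop_mul_push _)) hg (fun i j => ?_) (fun i j => ?_)
  · rw [← map_inv, diagHom, MonoidHom.comp_apply, Units.val_mul, val_diagUnits, diagonal_mul]
    rw [MonoidHom.pi_apply, MonoidHom.comp_apply, val_headUnits, map_inv]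
    exact (hdis (hent i j).1).1
  · rw [_root_.mul_inv_rev, inv_inv, diagHom, MonoidHom.comp_apply, Units.val_mul, val_diagUnits,
      mul_diagonal]
    exact (hdis (hent i j).2).2

end Embedding

theorem exists_lift_word {K H : Type*} [Group K] [Group H] (π : K →* H) {S : Set K}
    {w : List H} (hw : ∀ x ∈ w, x ∈ π '' S ∨ x⁻¹ ∈ π '' S) :
    ∃ v : List K, (∀ x ∈ v, x ∈ S ∨ x⁻¹ ∈ S) ∧ v.length = w.length ∧ π v.prod = w.prod := by
  induction w with
  | nil => exact ⟨[], by simp, rfl, map_one π⟩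
  | cons x w ih =>
    obtain ⟨v, hv, hl, hp⟩ := ih fun y hy => hw y (List.mem_cons_of_mem _ hy)
    obtain ⟨y, hy, rfl⟩ : ∃ y, (y ∈ S ∨ y⁻¹ ∈ S) ∧ π y = x := by
      rcases hw x List.mem_cons_self with ⟨y, hy, rfl⟩ | ⟨y, hy, hyx⟩
      · exact ⟨y, Or.inl hy, rfl⟩
      · exact ⟨y⁻¹, Or.inr (by simpa using hy), by rw [map_inv, hyx, inv_inv]⟩
    exact ⟨y :: v, by simpa [hy] using hv, by simp [hl], by simp [hp]⟩

section SimpleQuotient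

open Matrix

variable {ι E : Type*} [Fintype ι] [DecidableEq ι] [Ring E]

theorem normalIn_map_subtype {U : Type*} [Group U] {K : Subgroup U} (N : Subgroup K) [N.Normal] :
    NormalIn (N.map K.subtype) K := by
  refine ⟨Subgroup.map_subtype_le N, ?_⟩
  rintro k hk - ⟨m, hm, rfl⟩
  exact ⟨⟨k, hk⟩ * m * ⟨k, hk⟩⁻¹, Subgroup.Normal.conj_mem ‹_› m hm ⟨k, hk⟩, rfl⟩

/-- If the elementary matrices normally generate `K`, then `K` has a simple quotient in which they
survive. -/
theorem exists_isSimpleGroup_quotient_of_hasElem [Nontrivial E]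
    (h3 : ∀ i j : ι, ∃ k, k ≠ i ∧ k ≠ j) [Nonempty ι] {K : Subgroup (Matrix ι ι E)ˣ}
    (h1 : HasElem K (1 : E)) (hK : ∀ M, NormalIn M K → HasElem M (1 : E) → K ≤ M) :
    ∃ N : Subgroup K, ∃ _ : N.Normal, IsSimpleGroup (K ⧸ N) ∧
      ¬ HasElem (N.map K.subtype) (1 : E) := by
  obtain ⟨i⟩ := ‹Nonempty ι›
  obtain ⟨j, hji, -⟩ := h3 i i
  obtain ⟨e, heK, he⟩ := h1 i j hji.symm
  have he1 : (⟨e, heK⟩ : K) ≠ 1 := by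
    intro h
    have h : e = 1 := congrArg Subtype.val h
    rw [h, Units.val_one, left_eq_add] at he
    have := congrFun (congrFun he i) j
    rw [single_apply_same, Matrix.zero_apply] at this
    exact one_ne_zero this
  obtain ⟨N, hN, heN, hsimple⟩ := exists_isSimpleGroup_quotient he1 fun N hN h => by
    have hM := normalIn_map_subtype N
    have := hK _ hM (HasUnip.hasElem h3 hM h1 hji.symm ⟨e, ⟨_, h, rfl⟩, he⟩)
    rw [eq_top_iff]
    rintro ⟨x, hx⟩ -
    obtain ⟨y, hy, rfl⟩ := this hx
    exact hy
  refine ⟨N, hN, hsimple, fun h => heN ?_⟩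
  obtain ⟨u, ⟨v, hv, rfl⟩, hu⟩ := h i j hji.symm
  have : v = ⟨e, heK⟩ := Subtype.ext (Units.ext (hu.trans he.symm))
  exact this ▸ hv

end SimpleQuotient

theorem exists_simple_quotient_matGroup {G : Type*} [Group G] [DecidableEq G] (L : List G) :
    ∃ N : Subgroup (matGroup L), ∃ _ : N.Normal, IsSimpleGroup (matGroup L ⧸ N) ∧
      ¬ HasElem (N.map (matGroup L).subtype) (1 : FunEnd (List (ℤ × G))) := by
  have : Nontrivial (FunEnd (List (ℤ × G))) := by
    refine ⟨⟨1, 0, fun h => ?_⟩⟩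
    have := DFunLike.congr_fun h (fun _ => (1 : ZMod 2))
    exact one_ne_zero (congrFun this [])
  exact exists_isSimpleGroup_quotient_of_hasElem (exists_ne_ne (operators_length_pos L))
    (hasElem_one_matGroup L) fun M hM h =>
      twoGen_le_of_hasElem_one (operators_length_pos L) (getD_operators_zero L) hM h

/-- **Statement 3.** Every finitely generated group embeds quasi-isometrically as a subgroup of a
two-generated simple group. -/
theorem statement3 {G : Type u} [Group G] (hG : Group.FG G) :
    ∃ (H : Type u) (_ : Group H) (a b : H) (A : Finset G) (B : Finset H) (φ : G →* H),
      IsSimpleGroup H ∧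
      Subgroup.closure ({a, b} : Set H) = ⊤ ∧
      Subgroup.closure (A : Set G) = ⊤ ∧
      Subgroup.closure (B : Set H) = ⊤ ∧
      Function.Injective φ ∧
      ∃ C D : ℝ, 0 < C ∧ 0 < D ∧ ∀ g g' : G,
        (1 / C) * (wordDist (A : Set G) g g' : ℝ) - D
            ≤ (wordDist (B : Set H) (φ g) (φ g') : ℝ) ∧
        (wordDist (B : Set H) (φ g) (φ g') : ℝ)
            ≤ C * (wordDist (A : Set G) g g' : ℝ) + D := by
  classical
  obtain ⟨A, hA⟩ := Group.fg_def.1 hG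
  set L := A.toList with hLdef
  have hAL : {g | g ∈ L} = (A : Set G) := by
    ext g
    simp [hLdef]
  have hL : Subgroup.closure {g | g ∈ L} = ⊤ := by rw [hAL, hA]
  obtain ⟨N, hN, hsimple, hnot⟩ := exists_simple_quotient_matGroup L
  let K := matGroup L
  let a : K := ⟨rotUnit _ _, rotUnit_mem_twoGen⟩
  let b : K := ⟨sparseUnit _ _, Subgroup.subset_closure (Or.inr rfl)⟩
  have hab : ({a, b} : Set K) = Subtype.val ⁻¹' {rotUnit _ _,
      sparseUnit _ fun k => (operators L).getD k 0} := by
    ext x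
    simp [a, b, Subtype.ext_iff]
  let π := QuotientGroup.mk' N
  have hgen : Subgroup.closure ({π a, π b} : Set (K ⧸ N)) = ⊤ := by
    have : Subgroup.closure ({a, b} : Set K) = ⊤ := by
      rw [hab]
      exact Subgroup.closure_closure_coe_preimage
    rw [← Set.image_pair, ← MonoidHom.map_closure, this, ← MonoidHom.range_eq_map]
    exact MonoidHom.range_eq_top.2 (QuotientGroup.mk'_surjective N)
  let Φ : G →* K := (diagHom L).codRestrict K (diagHom_mem hL)
  have lower : ∀ g, wordDist (A : Set G) 1 g ≤ wordDist ({π a, π b} : Set (K ⧸ N)) 1 (π (Φ g)) := by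
    intro g
    by_contra! hlt
    obtain ⟨w, hw, hwl, hwg⟩ := exists_word hgen (π (Φ g))
    rw [← hwl] at hlt
    rw [← Set.image_pair] at hw
    obtain ⟨v, hv, hvl, hvw⟩ := exists_lift_word π hw
    rw [hab] at hv
    rw [← hvl] at hlt
    refine hnot (hasElem_one_of_length_lt hL (normalIn_map_subtype N) (g := g)
      (w := v.map Subtype.val) ?_ (by simpa [hAL] using hlt) ?_)
    · intro u hu
      obtain ⟨x, hx, rfl⟩ := List.mem_map.1 hu
      exact hv x hx
    · refine ⟨(Φ g)⁻¹ * v.prod, QuotientGroup.eq.1 (hwg.symm.trans hvw.symm), ?_⟩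
      rw [map_mul, map_inv, map_list_prod]
      rfl
  let C := A.sup fun s => wordDist ({π a, π b} : Set (K ⧸ N)) 1 (π (Φ s))
  have upper : ∀ g, wordDist ({π a, π b} : Set (K ⧸ N)) 1 (π (Φ g)) ≤
      C * wordDist (A : Set G) 1 g := wordDist_map_le hA hgen (π.comp Φ) fun s hs =>
    Finset.le_sup (f := fun s => wordDist ({π a, π b} : Set (K ⧸ N)) 1 (π (Φ s))) hs
  refine ⟨K ⧸ N, inferInstance, π a, π b, A, {π a, π b}, π.comp Φ, hsimple, hgen, hA, ?_, ?_,
    C + 1, 1, by positivity, one_pos, fun g g' => ?_⟩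
  · rwa [Finset.coe_pair]
  · rw [injective_iff_map_eq_one]
    intro g hg
    have h := lower g
    rw [show π (Φ g) = 1 from hg, wordDist_one_one] at h
    obtain ⟨w, -, hwl, rfl⟩ := exists_word hA g
    rw [List.length_eq_zero_iff.1 (hwl.trans (Nat.le_zero.1 h)), List.prod_nil]
  · rw [Finset.coe_pair, wordDist_eq g g', wordDist_eq (π.comp Φ g), ← map_inv, ← map_mul]
    have h1 := lower (g⁻¹ * g')
    have h2 := upper (g⁻¹ * g')
    change _ ≤ ((wordDist _ 1 (π (Φ (g⁻¹ * g'))) : ℕ) : ℝ) ∧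
      ((wordDist _ 1 (π (Φ (g⁻¹ * g'))) : ℕ) : ℝ) ≤ _
    generalize wordDist _ 1 (π (Φ (g⁻¹ * g'))) = d at *
    generalize wordDist (A : Set G) 1 (g⁻¹ * g') = l at *
    have h1' : (l : ℝ) ≤ d := by exact_mod_cast h1
    have h2' : (d : ℝ) ≤ C * l := by exact_mod_cast h2
    have hl : (0 : ℝ) ≤ l := l.cast_nonneg
    constructor
    · have : 1 / ((C : ℝ) + 1) * l ≤ 1 * l := by
        refine mul_le_mul_of_nonneg_right ?_ hl
        rw [div_le_one (by positivity)]
        linarith [(Nat.cast_nonneg C : (0 : ℝ) ≤ C)]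
      linarith
    · linarith

end TBT
end

section
/- Every finitely generated group G embeds isometrically as a subgroup of a finitely generated simple group: there exist a finitely generated simple group H, finite generating sets of G and of H, and an injective group homomorphism G → H that is an isometry onto its image with respect to the associated word metrics. -/
namespace TBT

universe u

section Cycles

variable {Y Z : Type*}

/-- Three injections with pairwise disjoint images. -/
structure Indep (a b c : Y → Z) : Prop where
  inj_a : Function.Injective a
  inj_b : Function.Injective b
  inj_c : Function.Injective c
  ab : ∀ y y', a y ≠ b y'
  bc : ∀ y y', b y ≠ c y'
  ca : ∀ y y', c y ≠ a y'

theorem Indep.rotate {a b c : Y → Z} (h : Indep a b c) : Indep b c a :=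
  ⟨h.inj_b, h.inj_c, h.inj_a, h.bc, h.ca, h.ab⟩

theorem Indep.swap {a b c : Y → Z} (h : Indep a b c) : Indep a c b :=
  ⟨h.inj_a, h.inj_c, h.inj_b, fun y y' => (h.ca y' y).symm, fun y y' => (h.bc y' y).symm,
    fun y y' => (h.ab y' y).symm⟩

theorem Indep.comp_perm {a b c : Y → Z} (h : Indep a b c) (e : Equiv.Perm Z) :
    Indep (e ∘ a) (e ∘ b) (e ∘ c) :=
  ⟨e.injective.comp h.inj_a, e.injective.comp h.inj_b, e.injective.comp h.inj_c,
    fun y y' hh => h.ab y y' (e.injective hh), fun y y' hh => h.bc y y' (e.injective hh),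
    fun y y' hh => h.ca y y' (e.injective hh)⟩

theorem Indep.comp_right {a b c : Y → Z} (h : Indep a b c) {f g k : Y → Y}
    (hf : Function.Injective f) (hg : Function.Injective g) (hk : Function.Injective k) :
    Indep (a ∘ f) (b ∘ g) (c ∘ k) :=
  ⟨h.inj_a.comp hf, h.inj_b.comp hg, h.inj_c.comp hk, fun _ _ => h.ab _ _, fun _ _ => h.bc _ _,
    fun _ _ => h.ca _ _⟩

/-- The point in the image of three maps with a given label and parameter. -/
def tripleFun (a b c : Y → Z) : Fin 3 × Y → Z := fun p => ![a, b, c] p.1 p.2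

theorem Indep.injective {a b c : Y → Z} (h : Indep a b c) :
    Function.Injective (tripleFun a b c) := by
  rintro ⟨i, y⟩ ⟨j, y'⟩ hh
  fin_cases i <;> fin_cases j <;> simp [tripleFun] at hh ⊢
  · exact h.inj_a hh
  · exact h.ab _ _ hh
  · exact h.ca _ _ hh.symm
  · exact h.ab _ _ hh.symm
  · exact h.inj_b hh
  · exact h.bc _ _ hh
  · exact h.ca _ _ hh
  · exact h.bc _ _ hh.symm
  · exact h.inj_c hh

open Classical in
/-- The permutation `a y ↦ b y ↦ c y ↦ a y`, where `a`, `b`, `c` are injections with pairwise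
disjoint images. -/
noncomputable def cyc (a b c : Y → Z) : Equiv.Perm Z :=
  if h : Function.Injective (tripleFun a b c) then
    Equiv.Perm.viaEmbedding ((finRotate 3).prodCongr (Equiv.refl Y)) ⟨_, h⟩
  else 1

variable {a b c : Y → Z}

theorem cyc_fst (h : Indep a b c) (y : Y) : cyc a b c (a y) = b y := by
  rw [cyc, dif_pos h.injective]
  exact Equiv.Perm.viaEmbedding_apply _ ⟨_, h.injective⟩ (0, y)

theorem cyc_snd (h : Indep a b c) (y : Y) : cyc a b c (b y) = c y := by
  rw [cyc, dif_pos h.injective]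
  exact Equiv.Perm.viaEmbedding_apply _ ⟨_, h.injective⟩ (1, y)

theorem cyc_trd (h : Indep a b c) (y : Y) : cyc a b c (c y) = a y := by
  rw [cyc, dif_pos h.injective]
  exact Equiv.Perm.viaEmbedding_apply _ ⟨_, h.injective⟩ (2, y)

theorem cyc_of_notMem (h : Indep a b c) {z : Z} (ha : ∀ y, z ≠ a y) (hb : ∀ y, z ≠ b y)
    (hc : ∀ y, z ≠ c y) : cyc a b c z = z := by
  rw [cyc, dif_pos h.injective]
  apply Equiv.Perm.viaEmbedding_apply_of_notMem
  rintro ⟨⟨i, y⟩, rfl⟩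
  fin_cases i
  · exact ha y rfl
  · exact hb y rfl
  · exact hc y rfl

theorem eq_cyc (h : Indep a b c) (f : Equiv.Perm Z) (ha : ∀ y, f (a y) = b y)
    (hb : ∀ y, f (b y) = c y) (hc : ∀ y, f (c y) = a y)
    (hf : ∀ z, (∀ y, z ≠ a y) → (∀ y, z ≠ b y) → (∀ y, z ≠ c y) → f z = z) : f = cyc a b c := by
  ext z
  by_cases h1 : ∃ y, z = a y
  · obtain ⟨y, rfl⟩ := h1
    rw [ha, cyc_fst h]
  by_cases h2 : ∃ y, z = b y
  · obtain ⟨y, rfl⟩ := h2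
    rw [hb, cyc_snd h]
  by_cases h3 : ∃ y, z = c y
  · obtain ⟨y, rfl⟩ := h3
    rw [hc, cyc_trd h]
  push Not at h1 h2 h3
  rw [hf z h1 h2 h3, cyc_of_notMem h h1 h2 h3]

theorem cyc_rotate (h : Indep a b c) : cyc a b c = cyc b c a :=
  eq_cyc h.rotate _ (cyc_snd h) (cyc_trd h) (cyc_fst h)
    fun _ h1 h2 h3 => cyc_of_notMem h h3 h1 h2

theorem cyc_conj (h : Indep a b c) (e : Equiv.Perm Z) :
    e * cyc a b c * e⁻¹ = cyc (e ∘ a) (e ∘ b) (e ∘ c) := by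
  refine eq_cyc (h.comp_perm e) _ (fun y => ?_) (fun y => ?_) (fun y => ?_)
    fun z h1 h2 h3 => ?_
  · simp [cyc_fst h]
  · simp [cyc_snd h]
  · simp [cyc_trd h]
  · have key : cyc a b c (e⁻¹ z) = e⁻¹ z := by
      apply cyc_of_notMem h
      · rintro y hy
        exact h1 y (by simp [← hy])
      · rintro y hy
        exact h2 y (by simp [← hy])
      · rintro y hy
        exact h3 y (by simp [← hy])
    rw [Equiv.Perm.mul_apply, Equiv.Perm.mul_apply, key]
    simp

theorem cyc_swap (h : Indep a b c) : cyc a c b = (cyc a b c)⁻¹ := by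
  symm
  refine eq_cyc h.swap _ (fun y => ?_) (fun y => ?_) (fun y => ?_) fun z h1 h2 h3 => ?_ <;>
    rw [Equiv.Perm.inv_eq_iff_eq]
  · exact (cyc_trd h y).symm
  · exact (cyc_snd h y).symm
  · exact (cyc_fst h y).symm
  · exact (cyc_of_notMem h h1 h3 h2).symm

theorem cyc_mul_self (h : Indep a b c) : cyc a b c * cyc a b c = (cyc a b c)⁻¹ := by
  rw [← cyc_swap h]
  refine eq_cyc h.swap _ (fun y => ?_) (fun y => ?_) (fun y => ?_) fun z h1 h2 h3 => ?_ <;>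
    rw [Equiv.Perm.mul_apply]
  · rw [cyc_fst h, cyc_snd h]
  · rw [cyc_trd h, cyc_fst h]
  · rw [cyc_snd h, cyc_trd h]
  · rw [cyc_of_notMem h h1 h3 h2, cyc_of_notMem h h1 h3 h2]

theorem cyc_conj_mem {K P : Subgroup (Equiv.Perm Z)} (hP : ∀ e ∈ K, ∀ p ∈ P, e * p * e⁻¹ ∈ P)
    (h : Indep a b c) {e : Equiv.Perm Z} (he : e ∈ K) :
    cyc (e ∘ a) (e ∘ b) (e ∘ c) ∈ P ↔ cyc a b c ∈ P := by
  rw [← cyc_conj h]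
  refine ⟨fun hh => ?_, hP e he _⟩
  simpa [mul_assoc] using hP e⁻¹ (K.inv_mem he) _ hh

/-- Twisting the first injection by a permutation of the parameters. -/
theorem cyc_twist_fst (h : Indep a b c) (g : Equiv.Perm Y) (y : Y) :
    (cyc (a ∘ g) b c * (cyc a b c)⁻¹) (a y) = a (g y) := by
  rw [Equiv.Perm.mul_apply, (Equiv.Perm.inv_eq_iff_eq.2 (cyc_trd h y).symm)]
  exact cyc_trd (h.comp_right g.injective Function.injective_id Function.injective_id) y

theorem cyc_twist_snd (h : Indep a b c) (g : Equiv.Perm Y) (y : Y) :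
    (cyc (a ∘ g) b c * (cyc a b c)⁻¹) (b y) = b (g⁻¹ y) := by
  have := cyc_fst (h.comp_right g.injective Function.injective_id Function.injective_id) (g⁻¹ y)
  rw [Equiv.Perm.mul_apply, (Equiv.Perm.inv_eq_iff_eq.2 (cyc_fst h y).symm)]
  simpa using this

theorem cyc_twist_of_notMem (h : Indep a b c) (g : Equiv.Perm Y) {z : Z} (ha : ∀ y, z ≠ a y)
    (hb : ∀ y, z ≠ b y) : (cyc (a ∘ g) b c * (cyc a b c)⁻¹) z = z := by
  have h' := h.comp_right g.injective Function.injective_id Function.injective_id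
  rw [Equiv.Perm.mul_apply]
  by_cases hc : ∃ y, z = c y
  · obtain ⟨y, rfl⟩ := hc
    rw [(Equiv.Perm.inv_eq_iff_eq.2 (cyc_snd h y).symm)]
    exact cyc_snd h' y
  · push Not at hc
    rw [(Equiv.Perm.inv_eq_iff_eq.2 (cyc_of_notMem h ha hb hc).symm)]
    exact cyc_of_notMem h' (fun y => ha _) hb hc

end Cycles

section Points

/-- The letters: the elements of `G`, and five letters on which `G` acts trivially. -/
abbrev Letter (G : Type u) : Type u := G ⊕ Fin 5

/-- An infinite word together with a label in `G`. -/
abbrev Pt (G : Type u) : Type u := Stream' (Letter G) × G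

/-- Ten copies (levels) of `Pt G`. -/
abbrev LPt (G : Type u) : Type u := Fin 10 × Pt G

variable {G : Type u} [Group G]

/-- The action of `G` on letters. -/
def letterAct (g : G) : Letter G → Letter G := Sum.map (g * ·) id

theorem letterAct_one (x : Letter G) : letterAct 1 x = x := by
  cases x <;> simp [letterAct]

theorem letterAct_mul (g h : G) (x : Letter G) :
    letterAct (g * h) x = letterAct g (letterAct h x) := by
  cases x <;> simp [letterAct, mul_assoc]

/-- The diagonal action of `G` on points. -/
def shiftFun (g : G) (y : Pt G) : Pt G := (y.1.map (letterAct g), g * y.2)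

theorem shiftFun_one (y : Pt G) : shiftFun 1 y = y := by
  refine Prod.ext (Stream'.ext fun n => ?_) (one_mul _)
  simp [shiftFun, Stream'.get_map, letterAct_one]

theorem shiftFun_mul (g h : G) (y : Pt G) : shiftFun (g * h) y = shiftFun g (shiftFun h y) := by
  refine Prod.ext (Stream'.ext fun n => ?_) (mul_assoc _ _ _)
  simp [shiftFun, Stream'.get_map, letterAct_mul]

/-- The diagonal action of `G` on points, by permutations. -/
def shift : G →* Equiv.Perm (Pt G) where
  toFun g := ⟨shiftFun g, shiftFun g⁻¹, fun y => by rw [← shiftFun_mul]; simp [shiftFun_one],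
    fun y => by rw [← shiftFun_mul]; simp [shiftFun_one]⟩
  map_one' := Equiv.ext shiftFun_one
  map_mul' g h := Equiv.ext (shiftFun_mul g h)

theorem shift_fst (g : G) (y : Pt G) : (shift g y).1 = y.1.map (letterAct g) := rfl

theorem shift_snd (g : G) (y : Pt G) : (shift g y).2 = g * y.2 := rfl

theorem shift_mul_apply (g h : G) (y : Pt G) : shift (g * h) y = shift g (shift h y) :=
  shiftFun_mul g h y

/-- Prepend a finite word. -/
def pre (w : List (Letter G)) (y : Pt G) : Pt G := (w ++ₛ y.1, y.2)

omit [Group G] in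
theorem pre_nil (y : Pt G) : pre [] y = y := rfl

omit [Group G] in
theorem pre_append (w v : List (Letter G)) (y : Pt G) : pre (w ++ v) y = pre w (pre v y) :=
  Prod.ext (Stream'.append_append_stream _ _ _) rfl

omit [Group G] in
theorem pre_injective (w : List (Letter G)) : Function.Injective (pre w) :=
  fun _ _ h =>
    Prod.ext (Stream'.append_right_injective _ _ _ (Prod.ext_iff.1 h).1) (Prod.ext_iff.1 h).2

theorem shift_pre (g : G) (w : List (Letter G)) (y : Pt G) :
    shift g (pre w y) = pre (w.map (letterAct g)) (shift g y) :=
  Prod.ext (Stream'.map_append_stream _ _ _) rfl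

omit [Group G] in
theorem pre_take_drop (n : ℕ) (y : Pt G) : pre (y.1.take n) (y.1.drop n, y.2) = y :=
  Prod.ext (Stream'.append_take_drop _ _) rfl

theorem exists_append_of_append_eq {α : Type*} {u w : List α} {s t : Stream' α}
    (h : u ++ₛ s = w ++ₛ t) (hl : u.length ≤ w.length) : ∃ v, w = u ++ v := by
  refine ⟨w.drop u.length, ?_⟩
  conv_lhs => rw [← List.take_append_drop u.length w]
  congr 1
  rw [← List.take_append_drop u.length w, Stream'.append_append_stream] at h
  exact (Stream'.append_left_injective _ _ _ _ h (by simp [hl])).symm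

/-- The self-map of `Pt G` with image the cone of `w`, twisted by `g`. -/
def cone (w : List (Letter G)) (g : G) (y : Pt G) : Pt G := pre w (shift g y)

theorem cone_injective (w : List (Letter G)) (g : G) : Function.Injective (cone w g) :=
  (pre_injective w).comp (shift g).injective

theorem cone_snd (w : List (Letter G)) (g : G) (y : Pt G) : (cone w g y).2 = g * y.2 := rfl

/-- The map `μ`, into level `i`. -/
def lvl (i : Fin 10) (μ : Pt G → Pt G) (y : Pt G) : LPt G := (i, μ y)

omit [Group G] in
theorem lvl_injective (i : Fin 10) {μ : Pt G → Pt G} (h : Function.Injective μ) :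
    Function.Injective (lvl i μ) := fun _ _ hh => h (congrArg Prod.snd hh)

omit [Group G] in
theorem lvl_ne {i j : Fin 10} (h : i ≠ j) (μ ν : Pt G → Pt G) (y y' : Pt G) :
    lvl i μ y ≠ lvl j ν y' := fun hh => h (congrArg Prod.fst hh)

omit [Group G] in
theorem indep_lvl {i j l : Fin 10} (hij : i ≠ j) (hjl : j ≠ l) (hli : l ≠ i)
    {μ ν ρ : Pt G → Pt G} (hμ : Function.Injective μ) (hν : Function.Injective ν)
    (hρ : Function.Injective ρ) : Indep (lvl i μ) (lvl j ν) (lvl l ρ) :=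
  ⟨lvl_injective i hμ, lvl_injective j hν, lvl_injective l hρ, lvl_ne hij _ _, lvl_ne hjl _ _,
    lvl_ne hli _ _⟩

theorem exists_fresh (S : List (Fin 10)) (h : S.length < 10) : ∃ l, l ∉ S := by
  obtain ⟨l, -, hl⟩ := Finset.exists_mem_notMem_of_card_lt_card
    (s := S.toFinset) (t := Finset.univ) ((List.toFinset_card_le S).trans_lt (by simpa using h))
  exact ⟨l, by simpa using hl⟩

/-- The finitely many maps that, together with composition, give all `cone w g`. -/
def basicMaps (S : Set G) : Set (Pt G → Pt G) :=
  (fun g => cone [] g) '' (insert 1 (S ∪ S⁻¹)) ∪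
    insert (cone [Sum.inl 1] 1) (Set.range fun t => cone [Sum.inr t] 1)

theorem basicMaps_finite {S : Set G} (hS : S.Finite) : (basicMaps S).Finite :=
  ((((hS.union hS.inv).insert 1).image _)).union ((Set.finite_range _).insert _)

theorem exists_cone_of_mem_basicMaps {S : Set G} {δ : Pt G → Pt G} (h : δ ∈ basicMaps S) :
    ∃ w g, δ = cone w g := by
  rcases h with ⟨g, -, rfl⟩ | rfl | ⟨t, rfl⟩
  exacts [⟨_, _, rfl⟩, ⟨_, _, rfl⟩, ⟨_, _, rfl⟩]

/-- The generating 3-cycles. -/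
def gens (S : Set G) : Set (Equiv.Perm (LPt G)) :=
  (fun p : (Fin 10 × Fin 10 × Fin 10) × (Pt G → Pt G) =>
    cyc (lvl p.1.1 p.2) (lvl p.1.2.1 id) (lvl p.1.2.2 id)) ''
    {p | p.2 ∈ basicMaps S ∧ p.1.1 ≠ p.1.2.1 ∧ p.1.2.1 ≠ p.1.2.2 ∧ p.1.2.2 ≠ p.1.1}

theorem gens_finite {S : Set G} (hS : S.Finite) : (gens S).Finite := by
  apply Set.Finite.image
  refine (Set.finite_univ.prod (basicMaps_finite hS)).subset ?_
  rintro p ⟨h, -⟩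
  exact ⟨trivial, h⟩

theorem mem_gens {S : Set G} {δ : Pt G → Pt G} (hδ : δ ∈ basicMaps S) {i j l : Fin 10}
    (hij : i ≠ j) (hjl : j ≠ l) (hli : l ≠ i) :
    cyc (lvl i δ) (lvl j id) (lvl l id) ∈ gens S :=
  ⟨((i, j, l), δ), ⟨hδ, hij, hjl, hli⟩, rfl⟩

/-- The group generated by `gens S`. -/
abbrev cycGroup (S : Set G) : Subgroup (Equiv.Perm (LPt G)) := Subgroup.closure (gens S)

/-- `μ` is injective, and all 3-cycles of levels twisted once by `μ` are in `cycGroup S`. -/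
def Good (S : Set G) (μ : Pt G → Pt G) : Prop :=
  Function.Injective μ ∧ ∀ i j l : Fin 10, i ≠ j → j ≠ l → l ≠ i →
    cyc (lvl i μ) (lvl j id) (lvl l id) ∈ cycGroup S

theorem cone_nil_one : cone ([] : List (Letter G)) (1 : G) = id := by
  funext y
  simp [cone, pre_nil]

theorem good_id (S : Set G) : Good S id := by
  refine ⟨Function.injective_id, fun i j l hij hjl hli => ?_⟩
  apply Subgroup.subset_closure
  refine mem_gens (S := S) ?_ hij hjl hli
  exact Or.inl ⟨1, Or.inl rfl, cone_nil_one⟩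

theorem Good.comp_basic {S : Set G} {μ δ : Pt G → Pt G} (hμ : Good S μ) (hδ : δ ∈ basicMaps S) :
    Good S (μ ∘ δ) := by
  have hδi : Function.Injective δ := by
    obtain ⟨w, g, rfl⟩ := exists_cone_of_mem_basicMaps hδ
    exact cone_injective w g
  refine ⟨hμ.1.comp hδi, fun i l r hil hlr hri => ?_⟩
  obtain ⟨j, hj⟩ := exists_fresh [i, l, r] (by simp)
  obtain ⟨k, hk⟩ := exists_fresh [i, l, r, j] (by simp)
  simp only [List.mem_cons, List.not_mem_nil, or_false, not_or] at hj hk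
  have hind : Indep (lvl i μ) (lvl k id) (lvl j id) :=
    indep_lvl (Ne.symm hk.1) hk.2.2.2 hj.1 hμ.1 Function.injective_id Function.injective_id
  have hind' : Indep (lvl j δ) (lvl l id) (lvl r id) :=
    indep_lvl hj.2.1 hlr (Ne.symm hj.2.2) hδi Function.injective_id Function.injective_id
  have he := hμ.2 i k j (Ne.symm hk.1) hk.2.2.2 hj.1
  have hfix : ∀ s, s ≠ i → s ≠ k → s ≠ j →
      cyc (lvl i μ) (lvl k id) (lvl j id) ∘ lvl s id = lvl s id := fun s h1 h2 h3 =>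
    funext fun y => cyc_of_notMem hind (lvl_ne h1 _ _ _) (lvl_ne h2 _ _ _) (lvl_ne h3 _ _ _)
  have h2 : cyc (lvl i μ) (lvl k id) (lvl j id) ∘ lvl j δ = lvl i (μ ∘ δ) :=
    funext fun y => cyc_trd hind (δ y)
  have := (cyc_conj_mem (P := cycGroup S)
    (fun e he p hp => mul_mem (mul_mem he hp) (inv_mem he)) hind' he).2
    (Subgroup.subset_closure (mem_gens hδ hj.2.1 hlr (Ne.symm hj.2.2)))
  rwa [h2, hfix l (Ne.symm hil) (Ne.symm hk.2.1) (Ne.symm hj.2.1),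
    hfix r hri (Ne.symm hk.2.2.1) (Ne.symm hj.2.2)] at this

theorem Good.comp_shift {S : Set G} (hS : Subgroup.closure S = ⊤) (g : G) :
    ∀ μ, Good S μ → Good S (μ ∘ shift g) := by
  have hg : g ∈ Subgroup.closure S := hS ▸ Subgroup.mem_top g
  suffices h : (∀ μ, Good S μ → Good S (μ ∘ shift g)) ∧
      (∀ μ, Good S μ → Good S (μ ∘ shift g⁻¹)) from h.1
  induction hg using Subgroup.closure_induction with
  | mem x hx =>
    exact ⟨fun μ hμ => hμ.comp_basic (Or.inl ⟨x, Or.inr (Or.inl hx), rfl⟩),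
      fun μ hμ => hμ.comp_basic (Or.inl ⟨x⁻¹, Or.inr (Or.inr (by simpa using hx)), rfl⟩)⟩
  | one =>
    have : (shift (1 : G) : Pt G → Pt G) = id := by simp
    simp only [inv_one, this, Function.comp_id]
    exact ⟨fun _ h => h, fun _ h => h⟩
  | mul x y _ _ hx hy =>
    refine ⟨fun μ hμ => ?_, fun μ hμ => ?_⟩
    · rw [map_mul]
      exact hy.1 _ (hx.1 μ hμ)
    · rw [mul_inv_rev, map_mul]
      exact hx.2 _ (hy.2 μ hμ)
  | inv x _ hx =>
    rw [inv_inv]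
    exact ⟨hx.2, hx.1⟩

theorem Good.comp_pre {S : Set G} (hS : Subgroup.closure S = ⊤) (w : List (Letter G)) :
    ∀ μ, Good S μ → Good S (μ ∘ pre w) := by
  induction w with
  | nil => exact fun μ h => h
  | cons x w ih =>
    intro μ hμ
    have key : Good S (μ ∘ pre [x]) := by
      rcases x with x | t
      · have h1 := Good.comp_shift hS x⁻¹ _ ((Good.comp_shift hS x μ hμ).comp_basic
          (δ := cone [Sum.inl 1] 1) (Or.inr (Or.inl rfl)))
        convert h1 using 1
        funext y
        simp only [Function.comp_apply, cone, map_one, Equiv.Perm.one_apply, shift_pre,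
          ← shift_mul_apply]
        simp [letterAct]
      · have h1 := hμ.comp_basic (δ := cone [Sum.inr t] 1) (Or.inr (Or.inr ⟨t, rfl⟩))
        convert h1 using 1
        funext y
        simp [cone]
    exact ih _ key

theorem good_cone {S : Set G} (hS : Subgroup.closure S = ⊤) (w : List (Letter G)) (g : G) :
    Good S (cone w g) :=
  Good.comp_shift hS g _ (Good.comp_pre hS w _ (good_id S))

/-- The subgroup `P` is normalized by `K`. -/
def NormalizedBy (K P : Subgroup (Equiv.Perm (LPt G))) : Prop := ∀ e ∈ K, ∀ p ∈ P, e * p * e⁻¹ ∈ P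

theorem cyc_mem_iff_fst {S : Set G} {P : Subgroup (Equiv.Perm (LPt G))}
    (hP : NormalizedBy (cycGroup S) P) {μ : Pt G → Pt G} (hμ : Good S μ) {i l r : Fin 10}
    (hil : i ≠ l) (hlr : l ≠ r) (hri : r ≠ i) {b c : Pt G → LPt G}
    (hind : Indep (lvl i μ) b c) (hb : ∀ y, (b y).1 ≠ l ∧ (b y).1 ≠ r)
    (hc : ∀ y, (c y).1 ≠ l ∧ (c y).1 ≠ r) :
    cyc (lvl i μ) b c ∈ P ↔ cyc (lvl l id) b c ∈ P := by
  have he := hμ.2 i l r hil hlr hri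
  have hie : Indep (lvl i μ) (lvl l id) (lvl r id) :=
    indep_lvl hil hlr hri hμ.1 Function.injective_id Function.injective_id
  have h1 : cyc (lvl i μ) (lvl l id) (lvl r id) ∘ lvl i μ = lvl l id :=
    funext fun y => cyc_fst hie y
  have h2 : cyc (lvl i μ) (lvl l id) (lvl r id) ∘ b = b := funext fun y =>
    cyc_of_notMem hie (fun y' hy => hind.ab y' y hy.symm)
      (fun y' hy => (hb y).1 (congrArg Prod.fst hy)) (fun y' hy => (hb y).2 (congrArg Prod.fst hy))
  have h3 : cyc (lvl i μ) (lvl l id) (lvl r id) ∘ c = c := funext fun y =>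
    cyc_of_notMem hie (fun y' hy => hind.ca y y' hy)
      (fun y' hy => (hc y).1 (congrArg Prod.fst hy)) (fun y' hy => (hc y).2 (congrArg Prod.fst hy))
  rw [← cyc_conj_mem hP hind he, h1, h2, h3]

theorem cyc_mem_iff_base {S : Set G} {P : Subgroup (Equiv.Perm (LPt G))}
    (hP : NormalizedBy (cycGroup S) P) {μ ν ρ : Pt G → Pt G} (hμ : Good S μ) (hν : Good S ν)
    (hρ : Good S ρ) {i j k l₁ l₂ l₃ : Fin 10} (hind : Indep (lvl i μ) (lvl j ν) (lvl k ρ))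
    (h12 : l₁ ≠ l₂) (h23 : l₂ ≠ l₃) (h31 : l₃ ≠ l₁) (h1 : l₁ ∉ [i, j, k]) (h2 : l₂ ∉ [i, j, k])
    (h3 : l₃ ∉ [i, j, k]) :
    cyc (lvl i μ) (lvl j ν) (lvl k ρ) ∈ P ↔ cyc (lvl l₁ id) (lvl l₂ id) (lvl l₃ id) ∈ P := by
  obtain ⟨r, hr⟩ := exists_fresh [i, j, k, l₁, l₂, l₃] (by simp)
  simp only [List.mem_cons, List.not_mem_nil, or_false, not_or, ← ne_eq] at h1 h2 h3 hr
  obtain ⟨ri, rj, rk, r1, r2, r3⟩ := hr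
  obtain ⟨i1, j1, k1⟩ := h1
  obtain ⟨i2, j2, k2⟩ := h2
  obtain ⟨i3, j3, k3⟩ := h3
  have id_inj : Function.Injective (id : Pt G → Pt G) := Function.injective_id
  have hi1 : Indep (lvl l₁ id) (lvl j ν) (lvl k ρ) :=
    ⟨lvl_injective _ id_inj, hind.inj_b, hind.inj_c, lvl_ne j1 _ _, hind.bc, lvl_ne k1.symm _ _⟩
  have hi2 : Indep (lvl l₂ id) (lvl k ρ) (lvl l₁ id) :=
    indep_lvl k2 k1.symm h12 id_inj hρ.1 id_inj
  have hi3 : Indep (lvl l₃ id) (lvl l₁ id) (lvl l₂ id) := indep_lvl h31 h12 h23 id_inj id_inj id_inj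
  rw [cyc_mem_iff_fst hP hμ i1.symm r1.symm ri hind (fun _ => ⟨j1.symm, rj.symm⟩)
      (fun _ => ⟨k1.symm, rk.symm⟩), cyc_rotate hi1,
    cyc_mem_iff_fst hP hν j2.symm r2.symm rj hi1.rotate (fun _ => ⟨k2.symm, rk.symm⟩)
      (fun _ => ⟨h12, r1.symm⟩), cyc_rotate hi2,
    cyc_mem_iff_fst hP hρ k3.symm r3.symm rk hi2.rotate (fun _ => ⟨h31.symm, r1.symm⟩)
      (fun _ => ⟨h23, r2.symm⟩), cyc_rotate hi3]

omit [Group G] in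
theorem normalizedBy_self (K : Subgroup (Equiv.Perm (LPt G))) : NormalizedBy K K :=
  fun _ he _ hp => mul_mem (mul_mem he hp) (inv_mem he)

theorem cyc_mem_cycGroup {S : Set G} {μ ν ρ : Pt G → Pt G} (hμ : Good S μ) (hν : Good S ν)
    (hρ : Good S ρ) {i j k : Fin 10} (hind : Indep (lvl i μ) (lvl j ν) (lvl k ρ)) :
    cyc (lvl i μ) (lvl j ν) (lvl k ρ) ∈ cycGroup S := by
  obtain ⟨l₁, h1⟩ := exists_fresh [i, j, k] (by simp)
  obtain ⟨l₂, h2⟩ := exists_fresh [l₁, i, j, k] (by simp)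
  obtain ⟨l₃, h3⟩ := exists_fresh [l₂, l₁, i, j, k] (by simp)
  rw [List.mem_cons, not_or] at h2 h3
  obtain ⟨h32, h3⟩ := h3
  rw [List.mem_cons, not_or] at h3
  rw [cyc_mem_iff_base (normalizedBy_self _) hμ hν hρ hind (Ne.symm h2.1) (Ne.symm h32) h3.1 h1
    h2.2 h3.2]
  exact (good_id S).2 _ _ _ (Ne.symm h2.1) (Ne.symm h32) h3.1

/-- A subgroup normalized by `cycGroup S` and containing one 3-cycle contains `cycGroup S`. -/
theorem cycGroup_le {S : Set G} (hS : Subgroup.closure S = ⊤) {P : Subgroup (Equiv.Perm (LPt G))}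
    (hP : NormalizedBy (cycGroup S) P) {μ ν ρ : Pt G → Pt G} (hμ : Good S μ) (hν : Good S ν)
    (hρ : Good S ρ) {i : Fin 10} (hind : Indep (lvl i μ) (lvl i ν) (lvl i ρ))
    (hmem : cyc (lvl i μ) (lvl i ν) (lvl i ρ) ∈ P) : cycGroup S ≤ P := by
  rw [Subgroup.closure_le]
  rintro _ ⟨⟨⟨a, b, c⟩, δ⟩, ⟨hδ, hab, hbc, hca⟩, rfl⟩
  dsimp only at hδ hab hbc hca ⊢
  have hgδ : Good S δ := by
    obtain ⟨w, g, rfl⟩ := exists_cone_of_mem_basicMaps hδ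
    exact good_cone hS w g
  obtain ⟨l₁, h1⟩ := exists_fresh [i, a, b, c] (by simp)
  obtain ⟨l₂, h2⟩ := exists_fresh [l₁, i, a, b, c] (by simp)
  obtain ⟨l₃, h3⟩ := exists_fresh [l₂, l₁, i, a, b, c] (by simp)
  simp only [List.mem_cons, List.not_mem_nil, or_false, not_or] at h1 h2 h3
  rw [SetLike.mem_coe, cyc_mem_iff_base hP hgδ (good_id S) (good_id S)
    (indep_lvl hab hbc hca hgδ.1 Function.injective_id Function.injective_id)
    (l₁ := l₁) (l₂ := l₂) (l₃ := l₃) (Ne.symm h2.1) (Ne.symm h3.1) h3.2.1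
    (by simp [h1]) (by simp [h2]) (by simp [h3])]
  rwa [← cyc_mem_iff_base hP hμ hν hρ hind (l₁ := l₁) (l₂ := l₂) (l₃ := l₃) (Ne.symm h2.1)
    (Ne.symm h3.1) h3.2.1 (by simp [h1]) (by simp [h2]) (by simp [h3])]

end Points

section Dynamics

variable {G : Type u} [Group G]

/-- Every sufficiently small cone is mapped to a prescribedly small cone by a change of prefix and
an element of `G`. -/
def EventuallyConical (h : Equiv.Perm (LPt G)) : Prop :=
  ∀ k, ∃ L, ∀ (i : Fin 10) (w : List (Letter G)), L ≤ w.length →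
    ∃ j w' g, k ≤ w'.length ∧ ∀ y, h (i, pre w y) = (j, cone w' g y)

theorem cone_shift (w : List (Letter G)) (g g' : G) (y : Pt G) :
    cone w g (shift g' y) = cone w (g * g') y := by
  rw [cone, cone, shift_mul_apply]

theorem EventuallyConical.mul {h h' : Equiv.Perm (LPt G)} (hh : EventuallyConical h)
    (hh' : EventuallyConical h') : EventuallyConical (h * h') := by
  intro k
  obtain ⟨L, hL⟩ := hh k
  obtain ⟨L', hL'⟩ := hh' L
  refine ⟨L', fun i w hw => ?_⟩
  obtain ⟨j, w', g, hw', h1⟩ := hL' i w hw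
  obtain ⟨j', w'', g', hw'', h2⟩ := hL j w' hw'
  refine ⟨j', w'', g' * g, hw'', fun y => ?_⟩
  rw [Equiv.Perm.mul_apply, h1, cone, h2, cone_shift]

theorem EventuallyConical.one : EventuallyConical (1 : Equiv.Perm (LPt G)) :=
  fun k => ⟨k, fun i w hw => ⟨i, w, 1, hw, fun y => by simp [cone]⟩⟩

theorem exists_cone_of_hit {h : Equiv.Perm (LPt G)} {i j : Fin 10} {u v : List (Letter G)} {a b : G}
    (hh : ∀ y, h (lvl i (cone u a) y) = lvl j (cone v b) y) {k : ℕ} {i₀ : Fin 10}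
    {w : List (Letter G)} (hw : u.length + k ≤ w.length) {y₀ y₁ : Pt G}
    (hit : (i₀, pre w y₀) = lvl i (cone u a) y₁) :
    ∃ j w' g, k ≤ w'.length ∧ ∀ y, h (i₀, pre w y) = (j, cone w' g y) := by
  obtain rfl : i₀ = i := congrArg Prod.fst hit
  obtain ⟨t, rfl⟩ : ∃ t, w = u ++ t :=
    exists_append_of_append_eq (congrArg (fun z : LPt G => z.2.1) hit).symm (by lia)
  refine ⟨j, v ++ t.map (letterAct (b * a⁻¹)), b * a⁻¹, ?_, fun y => ?_⟩
  · simp only [List.length_append, List.length_map] at hw ⊢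
    lia
  · have := hh (shift a⁻¹ (pre t y))
    simp only [lvl, cone_shift, mul_inv_cancel] at this
    rw [pre_append, cone, pre_append, ← shift_pre]
    simpa [cone] using this

theorem eventuallyConical_cyc {i j l : Fin 10} {u v w : List (Letter G)} {a b c : G}
    (hind : Indep (lvl i (cone u a)) (lvl j (cone v b)) (lvl l (cone w c))) :
    EventuallyConical (cyc (lvl i (cone u a)) (lvl j (cone v b)) (lvl l (cone w c))) := by
  intro k
  refine ⟨u.length + v.length + w.length + k, fun i₀ t ht => ?_⟩
  by_cases h1 : ∃ y₀ y₁, (i₀, pre t y₀) = lvl i (cone u a) y₁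
  · obtain ⟨y₀, y₁, hit⟩ := h1
    exact exists_cone_of_hit (cyc_fst hind) (by lia) hit
  by_cases h2 : ∃ y₀ y₁, (i₀, pre t y₀) = lvl j (cone v b) y₁
  · obtain ⟨y₀, y₁, hit⟩ := h2
    exact exists_cone_of_hit (cyc_snd hind) (by lia) hit
  by_cases h3 : ∃ y₀ y₁, (i₀, pre t y₀) = lvl l (cone w c) y₁
  · obtain ⟨y₀, y₁, hit⟩ := h3
    exact exists_cone_of_hit (cyc_trd hind) (by lia) hit
  push Not at h1 h2 h3
  refine ⟨i₀, t, 1, by lia, fun y => ?_⟩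
  rw [cyc_of_notMem hind (h1 y) (h2 y) (h3 y)]
  simp [cone]

theorem exists_eq_cyc_of_mem_gens {S : Set G} {h : Equiv.Perm (LPt G)} (hh : h ∈ gens S) :
    ∃ (i j l : Fin 10) (w : List (Letter G)) (g : G),
      Indep (lvl i (cone w g)) (lvl j (cone [] 1)) (lvl l (cone [] 1)) ∧
      h = cyc (lvl i (cone w g)) (lvl j (cone [] 1)) (lvl l (cone [] 1)) := by
  obtain ⟨⟨⟨i, j, l⟩, δ⟩, ⟨hδ, hij, hjl, hli⟩, rfl⟩ := hh
  obtain ⟨w, g, rfl⟩ := exists_cone_of_mem_basicMaps hδ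
  refine ⟨i, j, l, w, g, indep_lvl hij hjl hli (cone_injective _ _) (cone_injective _ _)
    (cone_injective _ _), ?_⟩
  rw [cone_nil_one]

theorem eventuallyConical_of_mem {S : Set G} {h : Equiv.Perm (LPt G)} (hh : h ∈ cycGroup S) :
    EventuallyConical h := by
  suffices EventuallyConical h ∧ EventuallyConical h⁻¹ from this.1
  induction hh using Subgroup.closure_induction with
  | mem x hx =>
    obtain ⟨i, j, l, w, g, hind, rfl⟩ := exists_eq_cyc_of_mem_gens hx
    have := eventuallyConical_cyc hind
    exact ⟨this, cyc_mul_self hind ▸ this.mul this⟩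
  | one => simpa using EventuallyConical.one
  | mul x y _ _ hx hy => exact ⟨hx.1.mul hy.1, mul_inv_rev x y ▸ hy.2.mul hx.2⟩
  | inv x _ hx => exact ⟨hx.2, (inv_inv x).symm ▸ hx.1⟩

theorem exists_get_ne {h : Equiv.Perm (LPt G)} (hh : EventuallyConical h) (h1 : h ≠ 1) :
    ∃ (i : Fin 10) (y : Pt G) (n : ℕ), (h (i, y)).1 ≠ i ∨ (h (i, y)).2.1.get n ≠ y.1.get n := by
  by_contra! H
  obtain ⟨⟨i, y⟩, hy⟩ : ∃ z, h z ≠ z := by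
    by_contra! hz
    exact h1 (Equiv.ext hz)
  obtain ⟨L, hL⟩ := hh 0
  obtain ⟨j, w', g, -, hw⟩ := hL i (y.1.take L) (by simp)
  have hg : g ≠ 1 := by
    rintro rfl
    apply hy
    refine Prod.ext (H i y 0).1 (Prod.ext (Stream'.ext (H i y · |>.2)) ?_)
    have := hw (y.1.drop L, y.2)
    rw [pre_take_drop] at this
    rw [this]
    simp [cone_snd]
  have h2 := (H i (pre (y.1.take L) (Stream'.const (Sum.inl 1), 1)) (L + w'.length)).2
  rw [hw, cone, pre, pre, shift_fst, Stream'.map_const, Nat.add_comm] at h2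
  dsimp only at h2
  rw [Stream'.get_append_right, Nat.add_comm] at h2
  have h3 : ((y.1.take L) ++ₛ Stream'.const (Sum.inl (1 : G))).get (L + w'.length) = Sum.inl 1 := by
    have := Stream'.get_append_right w'.length (y.1.take L) (Stream'.const (Sum.inl (1 : G)))
    rwa [Stream'.length_take] at this
  rw [h3] at h2
  apply hg
  simpa [letterAct, Stream'.get, Stream'.const] using h2

theorem exists_moved_cone {h : Equiv.Perm (LPt G)} (hh : EventuallyConical h) (h1 : h ≠ 1) :
    ∃ i w, ∀ y y', h (i, pre w y) ≠ (i, pre w y') := by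
  obtain ⟨i, y, n, hn⟩ := exists_get_ne hh h1
  obtain ⟨L, hL⟩ := hh (n + 1)
  obtain ⟨j, w', g, hw', hw⟩ := hL i (y.1.take (L + n + 1)) (by simp; lia)
  refine ⟨i, y.1.take (L + n + 1), fun y₁ y₂ H => ?_⟩
  have hy := hw (y.1.drop (L + n + 1), y.2)
  rw [pre_take_drop] at hy
  rw [hw] at H
  have hj : j = i := congrArg Prod.fst H
  have hget := congrArg (fun z : LPt G => z.2.1.get n) H
  simp only [cone, pre] at hget
  rw [Stream'.get_append_left n _ _ (by lia), Stream'.get_append_left n _ _ (by simp),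
    Stream'.take_get] at hget
  rcases hn with hn | hn
  · exact hn (by rw [hy, hj])
  · apply hn
    rw [hy]
    simp only [cone, pre]
    rw [Stream'.get_append_left n _ _ (by lia), hget]

theorem letter_cone_ne (i : Fin 10) (w : List (Letter G)) {s t : Fin 5} (h : s ≠ t) (y y' : Pt G) :
    lvl i (cone (w ++ [Sum.inr s]) 1) y ≠ lvl i (cone (w ++ [Sum.inr t]) 1) y' := by
  intro hh
  have h1 := congrArg Prod.snd hh
  simp only [lvl, cone, pre_append] at h1
  have h2 := congrArg (fun z : Pt G => z.1.get 0) (pre_injective w h1)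
  exact h (Sum.inr_injective h2)

theorem indep_letter_cone (i : Fin 10) (w : List (Letter G)) {r s t : Fin 5} (h₁ : r ≠ s)
    (h₂ : s ≠ t) (h₃ : t ≠ r) :
    Indep (lvl i (cone (w ++ [Sum.inr r]) 1)) (lvl i (cone (w ++ [Sum.inr s]) 1))
      (lvl i (cone (w ++ [Sum.inr t]) 1)) :=
  ⟨lvl_injective _ (cone_injective _ _), lvl_injective _ (cone_injective _ _),
    lvl_injective _ (cone_injective _ _), letter_cone_ne i w h₁, letter_cone_ne i w h₂,
    letter_cone_ne i w h₃⟩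

theorem cycGroup_le_of_ne_one {S : Set G} (hS : Subgroup.closure S = ⊤)
    {P : Subgroup (Equiv.Perm (LPt G))} (hP : NormalizedBy (cycGroup S) P) {h : Equiv.Perm (LPt G)}
    (hhP : h ∈ P) (hh : EventuallyConical h) (h1 : h ≠ 1) : cycGroup S ≤ P := by
  obtain ⟨i, w, hw⟩ := exists_moved_cone hh h1
  set c : Fin 5 → Pt G → LPt G := fun t => lvl i (cone (w ++ [Sum.inr t]) 1) with hc
  have hgood : ∀ t : Fin 5, Good S (cone (w ++ [Sum.inr t]) 1) := fun t => good_cone hS _ _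
  have hind : ∀ r s t : Fin 5, r ≠ s → s ≠ t → t ≠ r → Indep (c r) (c s) (c t) :=
    fun r s t => indep_letter_cone i w
  have hcK : ∀ r s t : Fin 5, r ≠ s → s ≠ t → t ≠ r → cyc (c r) (c s) (c t) ∈ cycGroup S :=
    fun r s t h₁ h₂ h₃ => cyc_mem_cycGroup (hgood r) (hgood s) (hgood t) (hind r s t h₁ h₂ h₃)
  have h123 := hind 1 2 3 (by decide) (by decide) (by decide)
  have h234 := hind 2 3 4 (by decide) (by decide) (by decide)
  have h012 := hind 0 1 2 (by decide) (by decide) (by decide)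
  have hc_pre : ∀ t y, ∃ y', c t y = (i, pre w y') := fun t y =>
    ⟨pre [Sum.inr t] y, by simp [hc, lvl, cone, pre_append]⟩
  set a := cyc (c 1) (c 2) (c 3) * cyc (c 2) (c 3) (c 4) with ha
  have haK : a ∈ cycGroup S := mul_mem (hcK 1 2 3 (by decide) (by decide) (by decide))
    (hcK 2 3 4 (by decide) (by decide) (by decide))
  have ha_fix : ∀ z, (∀ y, z ≠ (i, pre w y)) → a z = z := by
    intro z hz
    have hz' : ∀ t y, z ≠ c t y := fun t y hzc => by
      obtain ⟨y', hy'⟩ := hc_pre t y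
      exact hz y' (hzc.trans hy')
    rw [ha, Equiv.Perm.mul_apply, cyc_of_notMem h234 (hz' _) (hz' _) (hz' _),
      cyc_of_notMem h123 (hz' _) (hz' _) (hz' _)]
  set n := a * h * a⁻¹ * h⁻¹ with hn
  have hnP : n ∈ P := mul_mem (hP a haK h hhP) (inv_mem hhP)
  have hn_apply : ∀ t y, n (c t y) = a (c t y) := by
    intro t y
    have hfix : a (h⁻¹ (c t y)) = h⁻¹ (c t y) := by
      apply ha_fix
      intro y₁ hy₁
      obtain ⟨y₂, hy₂⟩ := hc_pre t y
      rw [Equiv.Perm.inv_eq_iff_eq, hy₂] at hy₁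
      exact hw y₁ y₂ hy₁.symm
    have hfix' : a⁻¹ (h⁻¹ (c t y)) = h⁻¹ (c t y) := Equiv.Perm.inv_eq_iff_eq.2 hfix.symm
    rw [hn, Equiv.Perm.mul_apply, Equiv.Perm.mul_apply, hfix', Equiv.Perm.mul_apply]
    simp
  have hne : ∀ {s t : Fin 5}, s ≠ t → ∀ y y', c s y ≠ c t y' := fun h => letter_cone_ne i w h
  have hn0 : n ∘ c 0 = c 0 := funext fun y => by
    rw [Function.comp_apply, hn_apply, ha, Equiv.Perm.mul_apply,
      cyc_of_notMem h234 (hne (by decide) y) (hne (by decide) y) (hne (by decide) y),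
      cyc_of_notMem h123 (hne (by decide) y) (hne (by decide) y) (hne (by decide) y)]
  have hn1 : n ∘ c 1 = c 2 := funext fun y => by
    rw [Function.comp_apply, hn_apply, ha, Equiv.Perm.mul_apply,
      cyc_of_notMem h234 (hne (by decide) y) (hne (by decide) y) (hne (by decide) y), cyc_fst h123]
  have hn2 : n ∘ c 2 = c 1 := funext fun y => by
    rw [Function.comp_apply, hn_apply, ha, Equiv.Perm.mul_apply, cyc_fst h234, cyc_trd h123]
  set x := cyc (c 0) (c 1) (c 2) with hx
  have hxK : x ∈ cycGroup S := hcK 0 1 2 (by decide) (by decide) (by decide)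
  have hnx : n * x * n⁻¹ = x⁻¹ := by
    rw [hx, cyc_conj h012, hn0, hn1, hn2, cyc_swap h012]
  have hxP : x ∈ P := by
    have h3 : n * (x * n⁻¹ * x⁻¹) = x := by
      rw [← mul_assoc, ← mul_assoc, hnx, ← mul_inv_rev, hx, cyc_mul_self h012, inv_inv]
    rw [← h3]
    exact mul_mem hnP (hP x hxK _ (inv_mem hnP))
  exact cycGroup_le hS hP (hgood 0) (hgood 1) (hgood 2) h012 hxP

theorem isSimpleGroup_cycGroup {S : Set G} (hS : Subgroup.closure S = ⊤) :
    IsSimpleGroup (cycGroup S) := by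
  have hnt : Nontrivial (cycGroup S) := by
    have hind : Indep (lvl 0 id) (lvl 1 id) (lvl 2 (id : Pt G → Pt G)) :=
      indep_lvl (by decide) (by decide) (by decide) Function.injective_id Function.injective_id
        Function.injective_id
    refine ⟨⟨⟨_, (good_id S).2 0 1 2 (by decide) (by decide) (by decide)⟩, 1, fun h => ?_⟩⟩
    have h1 := congrArg Subtype.val h
    have h2 := cyc_fst hind (Stream'.const (Sum.inl 1), 1)
    rw [show cyc _ _ _ = 1 from h1] at h2
    exact absurd (congrArg Prod.fst h2) (by simp [lvl])
  refine ⟨fun N hN => or_iff_not_imp_left.2 fun hbot => ?_⟩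
  obtain ⟨h, hhN, h1⟩ := N.bot_or_exists_ne_one.resolve_left hbot
  have hP : NormalizedBy (cycGroup S) (N.map (cycGroup S).subtype) := by
    rintro e he _ ⟨p, hp, rfl⟩
    exact ⟨⟨e, he⟩ * p * ⟨e, he⟩⁻¹, hN.conj_mem p hp ⟨e, he⟩, rfl⟩
  have hle := cycGroup_le_of_ne_one hS hP ⟨h, hhN, rfl⟩ (eventuallyConical_of_mem h.2)
    (fun hh => h1 (Subtype.ext hh))
  refine (Subgroup.eq_top_iff' N).2 fun x => ?_
  obtain ⟨p, hp, hpx⟩ := hle x.2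
  rwa [← Subtype.ext hpx]

end Dynamics

section Embedding

variable {G : Type u} [Group G]

open Classical in
/-- `G` acting on the part of level `0` outside the cone of the letter `Sum.inr 0`. -/
noncomputable def actFun (g : G) (z : LPt G) : LPt G :=
  if z.1 = 0 ∧ z.2.1.get 0 ≠ Sum.inr 0 then (z.1, shift g z.2) else z

theorem letterAct_eq_inr_iff (g : G) (x : Letter G) (t : Fin 5) :
    letterAct g x = Sum.inr t ↔ x = Sum.inr t := by
  cases x <;> simp [letterAct]

theorem actFun_one (z : LPt G) : actFun 1 z = z := by
  simp [actFun]

theorem actFun_mul (g h : G) (z : LPt G) : actFun (g * h) z = actFun g (actFun h z) := by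
  by_cases hz : z.1 = 0 ∧ z.2.1.get 0 ≠ Sum.inr 0
  · have h1 : actFun h z = (z.1, shift h z.2) := if_pos hz
    rw [h1, actFun, if_pos hz, actFun, if_pos, shift_mul_apply]
    refine ⟨hz.1, ?_⟩
    rw [shift_fst, Stream'.get_map, Ne, letterAct_eq_inr_iff]
    exact hz.2
  · rw [actFun, actFun, actFun, if_neg hz, if_neg hz, if_neg hz]

/-- `actFun`, by permutations. -/
noncomputable def actHom : G →* Equiv.Perm (LPt G) where
  toFun g := ⟨actFun g, actFun g⁻¹, fun y => by rw [← actFun_mul]; simp [actFun_one],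
    fun y => by rw [← actFun_mul]; simp [actFun_one]⟩
  map_one' := Equiv.ext actFun_one
  map_mul' g h := Equiv.ext (actFun_mul g h)

theorem actHom_apply (g : G) (z : LPt G) : actHom g z = actFun g z := rfl

theorem cone_one_comp_shift (w : List (Letter G)) (g : G) : cone w 1 ∘ shift g = cone w g := by
  funext y
  simp [cone]

theorem actHom_mem {S : Set G} (hS : Subgroup.closure S = ⊤) (g : G) :
    actHom g ∈ cycGroup S := by
  set a : Pt G → LPt G := lvl 0 (cone [] 1) with ha
  set b : Pt G → LPt G := lvl 1 (cone [] 1) with hb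
  set c : Pt G → LPt G := lvl 2 (cone [] 1) with hc
  set d : Pt G → LPt G := lvl 0 (cone [Sum.inr 0] 1) with hd
  have h1 : Indep a b c := indep_lvl (by decide) (by decide) (by decide) (cone_injective _ _)
    (cone_injective _ _) (cone_injective _ _)
  have h2 : Indep b d c := indep_lvl (by decide) (by decide) (by decide) (cone_injective _ _)
    (cone_injective _ _) (cone_injective _ _)
  have id_inj : Function.Injective (id : Pt G → Pt G) := Function.injective_id
  have h1' := h1.comp_right (shift g).injective id_inj id_inj
  have h2' := h2.comp_right (shift g).injective id_inj id_inj
  have hcone : ∀ (i : Fin 10) (w : List (Letter G)),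
      lvl i (cone w 1) ∘ shift g = lvl i (cone w g) := fun i w => by
    rw [← cone_one_comp_shift w g]
    rfl
  have m1 : cyc (a ∘ shift g) b c ∈ cycGroup S := by
    simp only [Function.comp_id] at h1'
    rw [ha, hcone] at h1' ⊢
    exact cyc_mem_cycGroup (good_cone hS _ _) (good_cone hS _ _) (good_cone hS _ _) h1'
  have m2 : cyc (b ∘ shift g) d c ∈ cycGroup S := by
    simp only [Function.comp_id] at h2'
    rw [hb, hcone] at h2' ⊢
    exact cyc_mem_cycGroup (good_cone hS _ _) (good_cone hS _ _) (good_cone hS _ _) h2'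
  have m3 : cyc a b c ∈ cycGroup S :=
    cyc_mem_cycGroup (good_cone hS _ _) (good_cone hS _ _) (good_cone hS _ _) h1
  have m4 : cyc b d c ∈ cycGroup S :=
    cyc_mem_cycGroup (good_cone hS _ _) (good_cone hS _ _) (good_cone hS _ _) h2
  suffices actHom g = cyc (a ∘ shift g) b c * (cyc a b c)⁻¹ *
      (cyc (b ∘ shift g) d c * (cyc b d c)⁻¹) by
    rw [this]
    exact mul_mem (mul_mem m1 (inv_mem m3)) (mul_mem m2 (inv_mem m4))
  have ha_eq : ∀ y, a y = (0, y) := fun y => by simp [ha, lvl, cone_nil_one]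
  have hb_eq : ∀ y, b y = (1, y) := fun y => by simp [hb, lvl, cone_nil_one]
  have hd_eq : ∀ y, d y = (0, pre [Sum.inr 0] y) := fun y => by simp [hd, lvl, cone]
  ext1 z
  rw [Equiv.Perm.mul_apply, actHom_apply, actFun]
  by_cases hz1 : z.1 = 1
  · obtain ⟨i, y⟩ := z
    obtain rfl : i = 1 := hz1
    rw [if_neg (by simp), ← hb_eq, cyc_twist_fst h2, cyc_twist_snd h1]
    simp
  by_cases hz0 : z.1 = 0
  · obtain ⟨i, y⟩ := z
    obtain rfl : i = 0 := hz0
    by_cases hy : y.1.get 0 = Sum.inr 0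
    · rw [if_neg (by simp [hy])]
      obtain ⟨y', rfl⟩ : ∃ y', y = pre [Sum.inr 0] y' := by
        refine ⟨(y.1.tail, y.2), Prod.ext ?_ rfl⟩
        have := Stream'.eta y.1
        rw [show y.1.head = Sum.inr 0 from hy] at this
        exact this.symm
      have hda : ∀ y, d y = a (pre [Sum.inr 0] y) := fun y => by rw [hd_eq, ha_eq]
      rw [← hd_eq, cyc_twist_snd h2, hda ((shift g)⁻¹ y'), cyc_twist_fst h1, ha_eq, shift_pre,
        hd_eq]
      simp [letterAct]
    · have hfst := cyc_twist_fst h1 (shift g) y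
      rw [ha_eq, ha_eq] at hfst
      rw [if_pos ⟨rfl, hy⟩, cyc_twist_of_notMem h2, hfst]
      · intro y' hy'
        rw [hb_eq] at hy'
        exact absurd (congrArg Prod.fst hy') (by simp)
      · intro y' hy'
        rw [hd_eq] at hy'
        exact hy (congrArg (fun z : LPt G => z.2.1.get 0) hy')
  · have hza : ∀ y, z ≠ a y := fun y hy => hz0 (by rw [hy, ha_eq])
    have hzb : ∀ y, z ≠ b y := fun y hy => hz1 (by rw [hy, hb_eq])
    have hzd : ∀ y, z ≠ d y := fun y hy => hz0 (by rw [hy, hd_eq])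
    rw [if_neg (fun h => hz0 h.1), cyc_twist_of_notMem h2 _ hzb hzd,
      cyc_twist_of_notMem h1 _ hza hzb]

/-- The change of label of `z` under `h`. -/
def disp (h : Equiv.Perm (LPt G)) (z : LPt G) : G := (h z).2.2 * z.2.2⁻¹

theorem disp_mul (h h' : Equiv.Perm (LPt G)) (z : LPt G) :
    disp (h * h') z = disp h (h' z) * disp h' z := by
  simp [disp, mul_assoc]

theorem disp_inv (h : Equiv.Perm (LPt G)) (z : LPt G) : disp h z = (disp h⁻¹ (h z))⁻¹ := by
  simp [disp]

theorem disp_actHom (g : G) (z : LPt G) : disp (actHom g) z = g ∨ disp (actHom g) z = 1 := by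
  by_cases hz : z.1 = 0 ∧ z.2.1.get 0 ≠ Sum.inr 0
  · left
    rw [disp, actHom_apply, actFun, if_pos hz, shift_snd, mul_inv_cancel_right]
  · right
    rw [disp, actHom_apply, actFun, if_neg hz, mul_inv_cancel]

theorem exists_disp_actHom : ∃ z : LPt G, ∀ g, disp (actHom g) z = g := by
  refine ⟨(0, (Stream'.const (Sum.inr 1), 1)), fun g => ?_⟩
  have h : (Stream'.const (Sum.inr 1 : Letter G)).get 0 ≠ Sum.inr 0 := by simp [Stream'.get_const]
  rw [disp, actHom_apply, actFun, if_pos ⟨rfl, h⟩, shift_snd, mul_inv_cancel_right]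

theorem finite_range_disp {S : Set G} {h : Equiv.Perm (LPt G)} (hh : h ∈ gens S) :
    (Set.range (disp h)).Finite := by
  obtain ⟨i, j, l, w, g, hind, rfl⟩ := exists_eq_cyc_of_mem_gens hh
  refine (Set.toFinite {1, g, g⁻¹}).subset ?_
  rintro _ ⟨z, rfl⟩
  rw [disp]
  by_cases h1 : ∃ y, z = lvl i (cone w g) y
  · obtain ⟨y, rfl⟩ := h1
    rw [cyc_fst hind]
    simp [lvl, cone_snd]
  by_cases h2 : ∃ y, z = lvl j (cone [] 1) y
  · obtain ⟨y, rfl⟩ := h2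
    rw [cyc_snd hind]
    simp [lvl]
  by_cases h3 : ∃ y, z = lvl l (cone [] 1) y
  · obtain ⟨y, rfl⟩ := h3
    rw [cyc_trd hind]
    simp [lvl, cone_snd]
  push Not at h1 h2 h3
  rw [cyc_of_notMem hind h1 h2 h3]
  simp

theorem exists_word_disp {A : Set G} {B : Set (Equiv.Perm (LPt G))}
    (hB : ∀ h ∈ B, ∀ z, disp h z ∈ A) (w : List (Equiv.Perm (LPt G)))
    (hw : ∀ x ∈ w, x ∈ B ∨ x⁻¹ ∈ B) (z : LPt G) :
    ∃ v : List G, (∀ x ∈ v, x ∈ A ∨ x⁻¹ ∈ A) ∧ v.length = w.length ∧ v.prod = disp w.prod z := by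
  induction w with
  | nil => exact ⟨[], by simp, rfl, by simp [disp]⟩
  | cons h w ih =>
    obtain ⟨v, hv, hl, hp⟩ := ih fun x hx => hw x (List.mem_cons_of_mem _ hx)
    refine ⟨disp h (w.prod z) :: v, ?_, by simp [hl], by simp [disp_mul, hp]⟩
    intro x hx
    rcases List.mem_cons.1 hx with rfl | hx
    · refine (hw h List.mem_cons_self).imp (fun hh => hB h hh _) fun hh => ?_
      rw [disp_inv, inv_inv]
      exact hB _ hh _
    · exact hv x hx

theorem wordDist_eq_s1 {A : Set G} {H : Type*} [Group H] {B : Set H} {φ : G →* H}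
    (h₁ : ∀ a ∈ A, φ a ∈ B)
    (h₂ : ∀ (w : List H) (g : G), (∀ x ∈ w, x ∈ B ∨ x⁻¹ ∈ B) → w.prod = φ g →
      ∃ v : List G, (∀ x ∈ v, x ∈ A ∨ x⁻¹ ∈ A) ∧ v.length = w.length ∧ v.prod = g) (g g' : G) :
    wordDist B (φ g) (φ g') = wordDist A g g' := by
  refine congrArg sInf (Set.ext fun n => ⟨?_, ?_⟩)
  · rintro ⟨w, hw, rfl, hp⟩
    exact h₂ w _ hw (by rw [hp, map_mul, map_inv])
  · rintro ⟨w, hw, rfl, hp⟩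
    refine ⟨w.map φ, ?_, by simp, by rw [← map_list_prod, hp, map_mul, map_inv]⟩
    intro x hx
    obtain ⟨a, ha, rfl⟩ := List.mem_map.1 hx
    exact (hw a ha).imp (h₁ a) fun h => by simpa using h₁ _ h

end Embedding

/-- **Statement 5.** Every finitely generated group embeds isometrically as a subgroup of a
finitely generated simple group. -/
theorem statement5 {G : Type u} [Group G] (hG : Group.FG G) :
    ∃ (H : Type u) (_ : Group H) (A : Finset G) (B : Finset H) (φ : G →* H),
      IsSimpleGroup H ∧
      Subgroup.closure (A : Set G) = ⊤ ∧
      Subgroup.closure (B : Set H) = ⊤ ∧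
      Function.Injective φ ∧
      ∀ g g' : G, wordDist (B : Set H) (φ g) (φ g') = wordDist (A : Set G) g g' := by
  obtain ⟨S, hS, hSfin⟩ := Group.fg_iff.1 hG
  have hAfin : (insert 1 (S ∪ ⋃ h ∈ gens S, Set.range (disp h))).Finite :=
    (hSfin.union ((gens_finite hSfin).biUnion fun h hh => finite_range_disp hh)).insert 1
  set A : Set G := insert 1 (S ∪ ⋃ h ∈ gens S, Set.range (disp h)) with hA
  let φ : G →* cycGroup S := actHom.codRestrict _ (actHom_mem hS)
  let B : Set (cycGroup S) := Subtype.val ⁻¹' gens S ∪ φ '' A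
  have hBfin : B.Finite :=
    ((gens_finite hSfin).preimage Subtype.val_injective.injOn).union (hAfin.image _)
  obtain ⟨z, hz⟩ := exists_disp_actHom (G := G)
  refine ⟨cycGroup S, inferInstance, hAfin.toFinset, hBfin.toFinset, φ,
    isSimpleGroup_cycGroup hS, ?_, ?_, fun g g' h => ?_, ?_⟩
  · rw [Set.Finite.coe_toFinset, eq_top_iff, ← hS]
    exact Subgroup.closure_mono fun x hx => Or.inr (Or.inl hx)
  · rw [Set.Finite.coe_toFinset, eq_top_iff, ← Subgroup.closure_closure_coe_preimage]
    exact Subgroup.closure_mono fun x hx => Or.inl hx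
  · rw [← hz g, ← hz g', show actHom g = actHom g' from congrArg Subtype.val h]
  · rw [Set.Finite.coe_toFinset, Set.Finite.coe_toFinset]
    refine wordDist_eq_s1 (fun a ha => Or.inr ⟨a, ha, rfl⟩) fun w g hw hp => ?_
    have hB : ∀ h ∈ Subtype.val '' B, ∀ z, disp h z ∈ A := by
      rintro _ ⟨h, hh | ⟨a, ha, rfl⟩, rfl⟩ z
      · exact Or.inr (Or.inr (Set.mem_biUnion hh ⟨z, rfl⟩))
      · rcases disp_actHom a z with h | h
        · exact h.symm ▸ ha
        · exact h.symm ▸ Or.inl rfl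
    obtain ⟨v, hv, hl, hvp⟩ := exists_word_disp hB (w.map (cycGroup S).subtype) (by
      intro x hx
      obtain ⟨x, hxw, rfl⟩ := List.mem_map.1 hx
      exact (hw x hxw).imp (fun h => ⟨x, h, rfl⟩) fun h => ⟨x⁻¹, h, rfl⟩) z
    refine ⟨v, hv, by simpa using hl, ?_⟩
    rw [hvp, ← map_list_prod, hp]
    exact hz g

end TBT
end
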